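/- Let a, b be nonzero integers with ab > 0. There exist α > 0, η > 0 and C > 0 such that for every sufficiently large prime q and all integers 1 ≤ l1, l2 ≤ q^α one has |(q−1)^{-1} · Σ_{χ} χ(l1)^a χ(l2)^b L(χ^a, 1/2) L(χ^b, 1/2) − δ| ≤ C·q^{-η}, where the sum runs over all nontrivial Dirichlet characters χ modulo q, and δ = 1 if l1 = l2 = 1 and δ = 0 otherwise. -/

import Mathlib

open scoped Real Classical

section Elimination

open Polynomial Matrix

theorem natDegree_det_le_card_mul {R n : Type*} [CommRing R] [Fintype n] [DecidableEq n]
    (M : Matrix n n R[X]) (d : ℕ) (hM : ∀ i j, (M i j).natDegree ≤ d) :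
    M.det.natDegree ≤ Fintype.card n * d := by
  rw [Matrix.det_apply]
  refine natDegree_sum_le_of_forall_le _ _ fun σ _ => ?_
  refine (natDegree_smul_le _ _).trans ?_
  refine (natDegree_prod_le _ _).trans ?_
  refine (Finset.sum_le_card_nsmul _ _ d fun i _ => hM _ _).trans ?_
  simp

variable {K ι : Type*} [Field K] [Fintype ι]

/-- Multiplication by the `i`-th coordinate on monomials of exponent `< b`, cleared of
denominators, when the `i`-th coordinate satisfies `y ^ b * p i = lam`. -/
noncomputable def mulMatrix (b : ℕ) [NeZero b] (p : ι → K[X]) (lam : K) (s : Finset ι) (i : ι) :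
    Matrix (ι → Fin b) (ι → Fin b) K[X] := fun e e' =>
  if h : (e i : ℕ) + 1 < b then
    (if e' = Function.update e i ⟨(e i : ℕ) + 1, h⟩ then ∏ j ∈ s, p j else 0)
  else (if e' = Function.update e i 0 then C lam * ∏ j ∈ s.erase i, p j else 0)

theorem mulMatrix_natDegree_le (b : ℕ) [NeZero b] (p : ι → K[X]) (lam : K) (s : Finset ι) (i : ι)
    (d : ℕ) (hd : ∀ j, (p j).natDegree ≤ d) (e e' : ι → Fin b) :
    (mulMatrix b p lam s i e e').natDegree ≤ Fintype.card ι * d := by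
  have key : ∀ t : Finset ι, (∏ j ∈ t, p j).natDegree ≤ Fintype.card ι * d := fun t =>
    (natDegree_prod_le _ _).trans <| (Finset.sum_le_card_nsmul _ _ d fun j _ => hd j).trans <| by
      simpa using Nat.mul_le_mul_right d (Finset.card_le_univ t)
  unfold mulMatrix
  split_ifs
  · exact key _
  · simp
  · exact (natDegree_C_mul_le _ _).trans (key _)
  · simp

theorem prod_pow_update (b : ℕ) (y : ι → K) (e : ι → Fin b) (i : ι) (k : Fin b) :
    ∏ j, y j ^ ((Function.update e i k) j : ℕ) =
      y i ^ (k : ℕ) * ∏ j ∈ Finset.univ.erase i, y j ^ (e j : ℕ) := by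
  rw [← Finset.mul_prod_erase Finset.univ _ (Finset.mem_univ i)]
  congr 1
  · simp
  · refine Finset.prod_congr rfl fun j hj => ?_
    rw [Function.update_of_ne (Finset.ne_of_mem_erase hj)]

theorem mulMatrix_eval_mulVec (b : ℕ) [NeZero b] (p : ι → K[X]) (lam : K) (s : Finset ι) {i : ι}
    (hi : i ∈ s) (x : K) (y : ι → K) (hy : y i ^ b * (p i).eval x = lam) :
    ((mulMatrix b p lam s i).map (eval x)) *ᵥ (fun e => ∏ j, y j ^ (e j : ℕ)) =
      ((∏ j ∈ s, p j).eval x * y i) • (fun e : ι → Fin b => ∏ j, y j ^ (e j : ℕ)) := by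
  ext e
  have hw : ∏ j, y j ^ (e j : ℕ) = y i ^ (e i : ℕ) * ∏ j ∈ Finset.univ.erase i, y j ^ (e j : ℕ) :=
    (Finset.mul_prod_erase Finset.univ _ (Finset.mem_univ i)).symm
  simp only [Matrix.mulVec, dotProduct, Matrix.map_apply, Pi.smul_apply, smul_eq_mul, mulMatrix]
  by_cases h : (e i : ℕ) + 1 < b
  · simp only [h, dite_true, apply_ite (eval x), eval_zero, ite_mul, zero_mul, Finset.sum_ite_eq',
      Finset.mem_univ, if_true, prod_pow_update]
    rw [hw]; ring
  · simp only [h, dite_false, apply_ite (eval x), eval_zero, ite_mul, zero_mul, Finset.sum_ite_eq',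
      Finset.mem_univ, if_true, prod_pow_update]
    have hb : (e i : ℕ) + 1 = b := by have := (e i).isLt; omega
    rw [hw, ← Finset.mul_prod_erase s p hi, eval_mul, eval_mul, eval_C]
    have : y i ^ (e i : ℕ) * y i = y i ^ b := by rw [← pow_succ, hb]
    simp only [Fin.val_zero, pow_zero]
    rw [← hy, ← this]; ring

/-- Fixing the value `ρ` of `y i₀ * x ^ a`, few `x` carry a solution of the system. -/
theorem exists_eliminant (a b : ℕ) (ha : 0 < a) (hb : 0 < b) (i₀ : ι) (u : ι → K)
    (hu : ∀ i, i ≠ i₀ → u i ≠ 0) (ε : ι → K) (hε : ε i₀ ≠ 0) (lam ρ : K)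
    (hρ : ρ ≠ 0) :
    ∃ P : K[X], P ≠ 0 ∧ P.natDegree ≤ b ^ Fintype.card ι * (Fintype.card ι * (a * b) + a) ∧
      ∀ (x : K) (y : ι → K), (∀ i, y i ^ b * (x ^ b + u i) ^ a = lam) → y i₀ * x ^ a = ρ →
        ∑ i, ε i * y i = 0 → P.eval x = 0 := by
  have : NeZero b := ⟨hb.ne'⟩
  set p : ι → K[X] := fun i => (X ^ b + C (u i)) ^ a with hp
  set s : Finset ι := Finset.univ.erase i₀ with hs
  set D : K[X] := ∏ j ∈ s, p j with hD
  set M : Matrix (ι → Fin b) (ι → Fin b) K[X] :=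
    (C (ε i₀ * ρ) * D) • (1 : Matrix (ι → Fin b) (ι → Fin b) K[X]) +
      ∑ i ∈ s, (X ^ a * C (ε i)) • mulMatrix b p lam s i with hM
  have hpd : ∀ j, (p j).natDegree ≤ a * b := fun j => by
    refine natDegree_pow_le.trans (Nat.mul_le_mul_left a ?_)
    exact natDegree_add_C.le.trans (natDegree_X_pow_le b)
  have hDd : D.natDegree ≤ Fintype.card ι * (a * b) :=
    (natDegree_prod_le _ _).trans <| (Finset.sum_le_card_nsmul _ _ _ fun j _ => hpd j).trans <| by
      simpa using Nat.mul_le_mul_right (a * b) (Finset.card_le_univ s)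
  have hmap : ∀ x : K, M.map (eval x) = (ε i₀ * ρ * D.eval x) • (1 : Matrix _ _ K) +
      ∑ i ∈ s, (x ^ a * ε i) • (mulMatrix b p lam s i).map (eval x) := by
    intro x
    ext e e'
    simp only [hM, Matrix.map_apply, Matrix.add_apply, Matrix.smul_apply, smul_eq_mul,
      Matrix.sum_apply, eval_add, eval_mul, eval_C, eval_finsetSum, eval_pow, eval_X,
      Matrix.one_apply, apply_ite (eval x), eval_one, eval_zero]
  have hdet : ∀ x : K, M.det.eval x = (M.map (eval x)).det := fun x => by
    rw [← coe_evalRingHom, RingHom.map_det]; rfl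
  refine ⟨M.det, ?_, ?_, ?_⟩
  · intro h0
    have h1 := hdet 0
    rw [h0, eval_zero, hmap] at h1
    simp only [zero_pow ha.ne', zero_mul, zero_smul, Finset.sum_const_zero, add_zero,
      Matrix.det_smul, Matrix.det_one, mul_one] at h1
    have h2 : ε i₀ * ρ * D.eval 0 ≠ 0 := by
      refine mul_ne_zero (mul_ne_zero hε hρ) ?_
      rw [hD, eval_prod, Finset.prod_ne_zero_iff]
      intro j hj
      simp only [hp, eval_pow, eval_add, eval_X, eval_C, zero_pow hb.ne', zero_add]
      exact pow_ne_zero _ (hu j (Finset.ne_of_mem_erase hj))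
    exact pow_ne_zero _ h2 h1.symm
  · have := natDegree_det_le_card_mul M (Fintype.card ι * (a * b) + a) fun e e' => ?_
    · rwa [Fintype.card_fun, Fintype.card_fin] at this
    · simp only [hM, Matrix.add_apply, Matrix.smul_apply, smul_eq_mul, Matrix.sum_apply]
      refine natDegree_add_le_of_degree_le ?_ (natDegree_sum_le_of_forall_le _ _ fun i _ => ?_)
      · rw [Matrix.one_apply]
        split_ifs
        · rw [mul_one]
          exact (natDegree_C_mul_le _ _).trans (hDd.trans (Nat.le_add_right _ _))
        · simp
      · refine natDegree_mul_le.trans ?_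
        rw [add_comm]
        exact add_le_add (mulMatrix_natDegree_le b p lam s i _ hpd e e')
          ((natDegree_mul_C_le _ _).trans (natDegree_X_pow_le a))
  · intro x y hy hyρ hsum
    rw [hdet]
    refine Matrix.exists_mulVec_eq_zero_iff.1
      ⟨fun e => ∏ j, y j ^ (e j : ℕ), fun h => ?_, ?_⟩
    · have := congrFun h 0
      simp at this
    · rw [hmap, Matrix.add_mulVec, Matrix.smul_mulVec, Matrix.one_mulVec, Matrix.sum_mulVec]
      have h1 : ∀ i ∈ s, ((x ^ a * ε i) • (mulMatrix b p lam s i).map (eval x)) *ᵥ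
          (fun e : ι → Fin b => ∏ j, y j ^ (e j : ℕ)) =
          (x ^ a * ε i * (D.eval x * y i)) • (fun e : ι → Fin b => ∏ j, y j ^ (e j : ℕ)) := by
        intro i hi
        rw [Matrix.smul_mulVec, mulMatrix_eval_mulVec b p lam s hi x y (by simpa [hp] using hy i),
          smul_smul]
      rw [Finset.sum_congr rfl h1, ← Finset.sum_smul, ← add_smul]
      have h2 : ε i₀ * ρ * D.eval x + ∑ i ∈ s, x ^ a * ε i * (D.eval x * y i) =
          x ^ a * D.eval x * ∑ i, ε i * y i := by
        rw [← Finset.add_sum_erase Finset.univ _ (Finset.mem_univ i₀), mul_add, Finset.mul_sum,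
          ← hyρ]
        congr 1
        · ring
        · exact Finset.sum_congr rfl fun i _ => by ring
      rw [h2, hsum, mul_zero, zero_smul]

/-- The bound for the number of shifts in `card_shift_le`. -/
def shiftBound (a b n : ℕ) : ℕ := b * (b ^ n * (n * (a * b) + a))

theorem card_shift_le_of_isAlgClosed [IsAlgClosed K] (a b : ℕ) (ha : 0 < a) (hb : 0 < b) (i₀ : ι)
    (v : ι → K) (hv : ∀ i, i ≠ i₀ → v i ≠ v i₀) (ε : ι → K) (hε : ε i₀ ≠ 0) (lam : K)
    (hlam : lam ≠ 0) (S : Finset K)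
    (hS : ∀ s ∈ S, ∃ y : ι → K, (∀ i, y i ^ b * (s + v i) ^ a = lam) ∧ ∑ i, ε i * y i = 0) :
    S.card ≤ shiftBound a b (Fintype.card ι) := by
  have hP : ∀ ρ : K, ρ ≠ 0 → _ := fun ρ hρ => exists_eliminant a b ha hb i₀ (fun i => v i - v i₀)
    (fun i hi => sub_ne_zero.2 (hv i hi)) ε hε lam ρ hρ
  choose! P hP0 hPd hPe using hP
  set T : Finset K := ((nthRoots b lam).toFinset.biUnion
    fun ρ => (P ρ).roots.toFinset.image fun x => x ^ b - v i₀) with hT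
  have hsub : S ⊆ T := by
    intro s hs
    obtain ⟨y, hy, hsum⟩ := hS s hs
    obtain ⟨x, hx⟩ := IsAlgClosed.exists_pow_nat_eq (s + v i₀) hb
    have hρ : (y i₀ * x ^ a) ^ b = lam := by
      rw [← hy i₀, ← hx, mul_pow, ← pow_mul, ← pow_mul, mul_comm a b]
    have hρ0 : y i₀ * x ^ a ≠ 0 := by
      intro h; rw [h, zero_pow hb.ne'] at hρ; exact hlam hρ.symm
    rw [hT, Finset.mem_biUnion]
    refine ⟨y i₀ * x ^ a, by simpa [mem_nthRoots hb] using hρ, ?_⟩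
    rw [Finset.mem_image]
    refine ⟨x, ?_, by rw [hx]; ring⟩
    rw [Multiset.mem_toFinset, mem_roots (hP0 _ hρ0)]
    refine hPe _ hρ0 x y (fun i => ?_) rfl hsum
    rw [hx, ← hy i]; ring
  refine (Finset.card_le_card hsub).trans (Finset.card_biUnion_le.trans ?_)
  have h1 : ∀ ρ ∈ (nthRoots b lam).toFinset,
      ((P ρ).roots.toFinset.image fun x => x ^ b - v i₀).card ≤
        b ^ Fintype.card ι * (Fintype.card ι * (a * b) + a) := by
    intro ρ hρ
    have hρ0 : ρ ≠ 0 := by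
      rintro rfl
      rw [Multiset.mem_toFinset, mem_nthRoots hb, zero_pow hb.ne'] at hρ
      exact hlam hρ.symm
    exact Finset.card_image_le.trans
      ((Multiset.toFinset_card_le _).trans ((card_roots' _).trans (hPd ρ hρ0)))
  refine (Finset.sum_le_card_nsmul _ _ _ h1).trans ?_
  rw [smul_eq_mul]
  exact Nat.mul_le_mul_right _ ((Multiset.toFinset_card_le _).trans (card_nthRoots b lam))

theorem card_shift_le (a b : ℕ) (ha : 0 < a) (hb : 0 < b) (i₀ : ι)
    (v : ι → K) (hv : ∀ i, i ≠ i₀ → v i ≠ v i₀) (ε : ι → K) (hε : ε i₀ ≠ 0) (lam : K)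
    (hlam : lam ≠ 0) (S : Finset K)
    (hS : ∀ s ∈ S, ∃ y : ι → K, (∀ i, y i ^ b * (s + v i) ^ a = lam) ∧ ∑ i, ε i * y i = 0) :
    S.card ≤ shiftBound a b (Fintype.card ι) := by
  set φ := algebraMap K (AlgebraicClosure K)
  have hφ : Function.Injective φ := φ.injective
  rw [← Finset.card_image_of_injective S hφ]
  refine card_shift_le_of_isAlgClosed a b ha hb i₀ (φ ∘ v) (fun i hi h => hv i hi (hφ h)) (φ ∘ ε)
    (by simpa using hε) (φ lam) (by simpa using hlam) _ fun s' hs' => ?_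
  obtain ⟨s, hs, rfl⟩ := Finset.mem_image.1 hs'
  obtain ⟨y, hy, hsum⟩ := hS s hs
  refine ⟨φ ∘ y, fun i => ?_, ?_⟩
  · rw [← hy i]; simp
  · simpa [map_sum] using congrArg φ hsum

end Elimination

section Moment

variable {q : ℕ} [Fact q.Prime]

/-- The exponential sum over the solutions `y` of `y ^ b * z ^ a = lam`. -/
noncomputable def fiberSum (a b : ℕ) (lam z : ZMod q) : ℂ :=
  ∑ y : ZMod q with y ^ b * z ^ a = lam, ZMod.stdAddChar y

theorem card_fiber_le (a : ℕ) {b : ℕ} (hb : 0 < b) {lam : ZMod q} (hlam : lam ≠ 0) (z : ZMod q) :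
    (Finset.univ.filter fun y : ZMod q => y ^ b * z ^ a = lam).card ≤ b := by
  refine le_trans (Finset.card_le_card ?_)
    ((Multiset.toFinset_card_le _).trans (Polynomial.card_nthRoots b (lam / z ^ a)))
  intro y hy
  rw [Finset.mem_filter] at hy
  have hz : z ^ a ≠ 0 := fun h => hlam (by rw [← hy.2, h, mul_zero])
  rw [Multiset.mem_toFinset, Polynomial.mem_nthRoots hb, eq_div_iff hz]
  exact hy.2

theorem norm_stdAddChar (y : ZMod q) : ‖(ZMod.stdAddChar y : ℂ)‖ = 1 := by
  simp

theorem sum_stdAddChar_mul (t : ZMod q) :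
    ∑ μ ∈ Finset.univ.erase (0 : ZMod q), (ZMod.stdAddChar (μ * t) : ℂ) =
      (if t = 0 then (q : ℂ) else 0) - 1 := by
  have h := AddChar.sum_mulShift t (ZMod.isPrimitive_stdAddChar q)
  rw [← Finset.add_sum_erase Finset.univ _ (Finset.mem_univ (0 : ZMod q))] at h
  simp only [zero_mul, AddChar.map_zero_eq_one, ZMod.card] at h
  have h' : (((if t = 0 then q else 0 : ℕ)) : ℂ) = if t = 0 then (q : ℂ) else 0 := by
    split_ifs <;> simp
  rw [h'] at h
  rw [← h]; ring

theorem addChar_map_sum {G : Type*} [AddCommMonoid G] {ι : Type*} (ψ : AddChar G ℂ)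
    (s : Finset ι) (f : ι → G) : ψ (∑ i ∈ s, f i) = ∏ i ∈ s, ψ (f i) := by
  induction s using Finset.induction_on with
  | empty => simp
  | insert i s hi ih => rw [Finset.sum_insert hi, Finset.prod_insert hi, ψ.map_add_eq_mul, ih]

/-- The solution tuples `y` of the system `y i ^ b * (z i) ^ a = lam`. -/
noncomputable def fiberTuples {ι : Type*} [Fintype ι] (a b : ℕ) (z : ι → ZMod q) (lam : ZMod q) :
    Finset (ι → ZMod q) :=
  Fintype.piFinset fun i => Finset.univ.filter fun y : ZMod q => y ^ b * z i ^ a = lam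

theorem mem_fiberTuples {ι : Type*} [Fintype ι] {a b : ℕ} {z : ι → ZMod q} {lam : ZMod q}
    {y : ι → ZMod q} : y ∈ fiberTuples a b z lam ↔ ∀ i, y i ^ b * z i ^ a = lam := by
  simp [fiberTuples]

theorem card_fiberTuples_le {ι : Type*} [Fintype ι] (a : ℕ) {b : ℕ} (hb : 0 < b)
    (z : ι → ZMod q) {lam : ZMod q} (hlam : lam ≠ 0) :
    (fiberTuples a b z lam).card ≤ b ^ Fintype.card ι := by
  rw [fiberTuples, Fintype.card_piFinset]
  exact (Finset.prod_le_prod' fun i _ => card_fiber_le a hb hlam (z i)).trans (by simp)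

/-- By invariance of the solution set under scaling, the exponential sum over it is at most
the number of its points on the hyperplane. -/
theorem re_sum_fiberTuples_le {ι : Type*} [Fintype ι] (a b : ℕ) (z ε : ι → ZMod q) :
    (∑ lam ∈ Finset.univ.erase (0 : ZMod q), ∑ y ∈ fiberTuples a b z lam,
        (ZMod.stdAddChar (∑ i, ε i * y i) : ℂ)).re ≤
      ∑ lam ∈ Finset.univ.erase (0 : ZMod q),
        (((fiberTuples a b z lam).filter fun y => ∑ i, ε i * y i = 0).card : ℝ) := by
  set E := Finset.univ.erase (0 : ZMod q) with hE
  set W := ∑ lam ∈ E, ∑ y ∈ fiberTuples a b z lam, (ZMod.stdAddChar (∑ i, ε i * y i) : ℂ) with hW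
  have hscale : ∀ μ ∈ E, W = ∑ lam ∈ E, ∑ y ∈ fiberTuples a b z lam,
      (ZMod.stdAddChar (μ * ∑ i, ε i * y i) : ℂ) := by
    intro μ hμ
    have hμ0 : μ ≠ 0 := Finset.ne_of_mem_erase hμ
    symm
    rw [hW]
    refine Finset.sum_bij (fun lam _ => μ ^ b * lam) ?_ ?_ ?_ ?_
    · intro lam hlam
      simpa [hE, hμ0] using hlam
    · intro x _ y _ h
      exact mul_left_cancel₀ (pow_ne_zero b hμ0) h
    · intro lam hlam
      refine ⟨(μ ^ b)⁻¹ * lam, by simpa [hE, hμ0] using hlam, ?_⟩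
      rw [mul_inv_cancel_left₀ (pow_ne_zero b hμ0)]
    · intro lam _
      refine Finset.sum_bij (fun y _ i => μ * y i) ?_ ?_ ?_ ?_
      · intro y hy
        rw [mem_fiberTuples] at hy ⊢
        intro i; rw [mul_pow, mul_assoc, hy i]
      · intro x _ y _ h
        funext i
        exact mul_left_cancel₀ hμ0 (congrFun h i)
      · intro y hy
        rw [mem_fiberTuples] at hy
        refine ⟨fun i => μ⁻¹ * y i, ?_, ?_⟩
        · rw [mem_fiberTuples]
          intro i
          rw [mul_pow, mul_assoc, hy i, ← mul_assoc, ← mul_pow, inv_mul_cancel₀ hμ0, one_pow,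
            one_mul]
        · funext i; rw [mul_inv_cancel_left₀ hμ0]
      · intro y _
        congr 1
        rw [Finset.mul_sum]
        exact Finset.sum_congr rfl fun i _ => by ring
  have hcard : E.card = q - 1 := by simp [hE, Finset.card_erase_of_mem, ZMod.card]
  have hq2 : 2 ≤ q := (Fact.out : q.Prime).two_le
  have hcardR : (E.card : ℝ) = q - 1 := by rw [hcard, Nat.cast_sub (by omega)]; simp
  have h1 : (E.card : ℂ) * W = ∑ lam ∈ E, ∑ y ∈ fiberTuples a b z lam,
      ((if ∑ i, ε i * y i = 0 then (q : ℂ) else 0) - 1) := by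
    rw [← nsmul_eq_mul, ← Finset.sum_const, Finset.sum_congr rfl hscale, Finset.sum_comm]
    refine Finset.sum_congr rfl fun lam _ => ?_
    rw [Finset.sum_comm]
    exact Finset.sum_congr rfl fun y _ => sum_stdAddChar_mul _
  have h2 := congrArg Complex.re h1
  rw [← Complex.ofReal_natCast, Complex.re_ofReal_mul, hcardR] at h2
  have h3 : (∑ lam ∈ E, ∑ y ∈ fiberTuples a b z lam,
      ((if ∑ i, ε i * y i = 0 then (q : ℂ) else 0) - 1)).re ≤ (q - 1 : ℝ) * ∑ lam ∈ E,
        (((fiberTuples a b z lam).filter fun y => ∑ i, ε i * y i = 0).card : ℝ) := by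
    rw [Complex.re_sum, Finset.mul_sum]
    refine Finset.sum_le_sum fun lam _ => ?_
    rw [Complex.re_sum, Finset.card_filter, Nat.cast_sum, Finset.mul_sum]
    refine Finset.sum_le_sum fun y _ => ?_
    split_ifs <;> simp
  rw [← h2] at h3
  have : (0 : ℝ) < q - 1 := by
    have : (2 : ℝ) ≤ q := by exact_mod_cast hq2
    linarith
  exact le_of_mul_le_mul_left h3 this

theorem norm_pow_eq_sum {a b : ℕ} (l : ℕ) (𝒱 : Finset (ZMod q)) (lam s : ZMod q) :
    ((‖∑ v ∈ 𝒱, fiberSum a b lam (s + v)‖ ^ (2 * l) : ℝ) : ℂ) =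
      ∑ v ∈ Fintype.piFinset fun _ : Fin l ⊕ Fin l => 𝒱,
        ∑ y ∈ fiberTuples a b (fun i => s + v i) lam,
          (ZMod.stdAddChar (∑ i, (Sum.elim 1 (-1) : Fin l ⊕ Fin l → ZMod q) i * y i) : ℂ) := by
  set T := ∑ v ∈ 𝒱, fiberSum a b lam (s + v) with hT
  have h1 : ((‖T‖ ^ (2 * l) : ℝ) : ℂ) = T ^ l * (starRingEnd ℂ T) ^ l := by
    rw [← mul_pow, Complex.mul_conj, pow_mul, Complex.normSq_eq_norm_sq]; push_cast; rfl
  have h2 : T ^ l * (starRingEnd ℂ T) ^ l = ∏ i : Fin l ⊕ Fin l, ∑ v ∈ 𝒱,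
      ∑ y : ZMod q with y ^ b * (s + v) ^ a = lam,
        (ZMod.stdAddChar ((Sum.elim 1 (-1) : Fin l ⊕ Fin l → ZMod q) i * y) : ℂ) := by
    rw [Fintype.prod_sum_type]
    simp only [Sum.elim_inl, Sum.elim_inr, Pi.one_apply, Pi.neg_apply, one_mul, neg_mul,
      Finset.prod_const, Finset.card_univ, Fintype.card_fin]
    congr 2
    rw [hT, map_sum]
    refine Finset.sum_congr rfl fun v _ => ?_
    rw [fiberSum, map_sum]
    exact Finset.sum_congr rfl fun y _ => (AddChar.map_neg_eq_conj _ _).symm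
  rw [h1, h2, Finset.prod_univ_sum]
  refine Finset.sum_congr rfl fun v _ => ?_
  rw [Finset.prod_univ_sum]
  refine Finset.sum_congr ?_ fun y _ => (addChar_map_sum _ _ _).symm
  ext y; simp [mem_fiberTuples, Fintype.mem_piFinset]

theorem card_piFinset_no_unique_le {α : Type*} {l : ℕ} (hl : 0 < l) (𝒱 : Finset α) :
    ((Fintype.piFinset fun _ : Fin l ⊕ Fin l => 𝒱).filter
      fun v => ∀ i, ∃ j, j ≠ i ∧ v j = v i).card ≤ l ^ (2 * l) * 𝒱.card ^ l := by
  set S : Finset ((Fin l ⊕ Fin l → Fin l) × (Fin l → α)) :=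
    Finset.univ ×ˢ Fintype.piFinset fun _ : Fin l => 𝒱 with hS
  have hScard : S.card = l ^ (2 * l) * 𝒱.card ^ l := by
    rw [hS, Finset.card_product, Finset.card_univ, Fintype.card_fun, Fintype.card_piFinset]
    simp [two_mul]
  rw [← hScard]
  refine (Finset.card_le_card (t := S.image fun p => p.2 ∘ p.1) ?_).trans Finset.card_image_le
  intro v hv
  rw [Finset.mem_filter, Fintype.mem_piFinset] at hv
  obtain ⟨hv𝒱, hv⟩ := hv
  have him : (Finset.univ.image v).card ≤ l := by
    have h1 : 2 * (Finset.univ.image v).card ≤ (Finset.univ : Finset (Fin l ⊕ Fin l)).card := by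
      refine Finset.mul_card_image_le_card _ 2 fun x hx => ?_
      obtain ⟨i, -, rfl⟩ := Finset.mem_image.1 hx
      obtain ⟨j, hji, hj⟩ := hv i
      exact Finset.one_lt_card.2 ⟨i, by simp, j, by simp [hj], hji.symm⟩
    simp at h1; omega
  have hemb : Nonempty ((Finset.univ.image v : Finset α) ↪ Fin l) := by
    rw [Function.Embedding.nonempty_iff_card_le]
    simpa using him
  obtain ⟨φ⟩ := hemb
  let i₁ : Fin l ⊕ Fin l := Sum.inl ⟨0, hl⟩
  have hmem : ∀ i, v i ∈ Finset.univ.image v := fun i => Finset.mem_image_of_mem v (Finset.mem_univ i)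
  let g : Fin l → α := fun k => if h : ∃ i, φ ⟨v i, hmem i⟩ = k then v h.choose else v i₁
  rw [Finset.mem_image]
  refine ⟨(fun i => φ ⟨v i, hmem i⟩, g), ?_, ?_⟩
  · rw [hS, Finset.mem_product]
    refine ⟨Finset.mem_univ _, ?_⟩
    rw [Fintype.mem_piFinset]
    intro k
    show (if h : _ then _ else _) ∈ 𝒱
    split_ifs
    · exact hv𝒱 _
    · exact hv𝒱 _
  · funext i
    have h : ∃ i', φ ⟨v i', hmem i'⟩ = φ ⟨v i, hmem i⟩ := ⟨i, rfl⟩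
    show (if h : _ then _ else _) = v i
    rw [dif_pos h]
    have := φ.injective h.choose_spec
    simpa using this

/-- The implied constant of `moment_le`. -/
def momentConst (a b l : ℕ) : ℕ := b ^ (2 * l) * (l ^ (2 * l) + shiftBound a b (2 * l))

theorem sum_card_filter_le_of_no_unique {a b : ℕ} (hb : 0 < b) {ι : Type*} [Fintype ι]
    (v ε : ι → ZMod q) :
    ∑ s : ZMod q, ∑ lam ∈ Finset.univ.erase (0 : ZMod q),
      (((fiberTuples a b (fun i => s + v i) lam).filter fun y => ∑ i, ε i * y i = 0).card : ℝ) ≤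
      (q : ℝ) ^ 2 * b ^ Fintype.card ι := by
  have h : ∀ s : ZMod q, ∀ lam ∈ Finset.univ.erase (0 : ZMod q),
      (((fiberTuples a b (fun i => s + v i) lam).filter fun y => ∑ i, ε i * y i = 0).card : ℝ) ≤
      (b : ℝ) ^ Fintype.card ι := by
    intro s lam hlam
    exact_mod_cast (Finset.card_filter_le _ _).trans
      (card_fiberTuples_le a hb _ (Finset.ne_of_mem_erase hlam))
  have h2 : ((Finset.univ.erase (0 : ZMod q)).card : ℝ) ≤ q := by
    exact_mod_cast (Finset.card_le_univ _).trans_eq (ZMod.card q)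
  calc _ ≤ ∑ s : ZMod q, ∑ lam ∈ Finset.univ.erase (0 : ZMod q), (b : ℝ) ^ Fintype.card ι :=
        Finset.sum_le_sum fun s _ => Finset.sum_le_sum (h s)
    _ = q * ((Finset.univ.erase (0 : ZMod q)).card * (b : ℝ) ^ Fintype.card ι) := by
        simp only [Finset.sum_const, nsmul_eq_mul, Finset.card_univ, ZMod.card]
    _ ≤ q * (q * (b : ℝ) ^ Fintype.card ι) := by gcongr
    _ = _ := by ring

theorem sum_card_filter_le_of_unique {a b : ℕ} (ha : 0 < a) (hb : 0 < b) {ι : Type*} [Fintype ι]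
    (v ε : ι → ZMod q) {i₀ : ι} (hv : ∀ i, i ≠ i₀ → v i ≠ v i₀) (hε : ε i₀ ≠ 0) :
    ∑ s : ZMod q, ∑ lam ∈ Finset.univ.erase (0 : ZMod q),
      (((fiberTuples a b (fun i => s + v i) lam).filter fun y => ∑ i, ε i * y i = 0).card : ℝ) ≤
      (q : ℝ) * (shiftBound a b (Fintype.card ι) * b ^ Fintype.card ι) := by
  rw [Finset.sum_comm]
  have h2 : ((Finset.univ.erase (0 : ZMod q)).card : ℝ) ≤ q := by
    exact_mod_cast (Finset.card_le_univ _).trans_eq (ZMod.card q)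
  refine (Finset.sum_le_card_nsmul _ _
    (shiftBound a b (Fintype.card ι) * b ^ Fintype.card ι : ℝ) fun lam hlam => ?_).trans ?_
  · have hlam0 := Finset.ne_of_mem_erase hlam
    set S := Finset.univ.filter fun s : ZMod q =>
      ((fiberTuples a b (fun i => s + v i) lam).filter fun y => ∑ i, ε i * y i = 0).Nonempty with hS
    have hcard : S.card ≤ shiftBound a b (Fintype.card ι) := by
      refine card_shift_le a b ha hb i₀ v hv ε hε lam hlam0 S fun s hs => ?_
      obtain ⟨y, hy⟩ := (Finset.mem_filter.1 hs).2
      rw [Finset.mem_filter, mem_fiberTuples] at hy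
      exact ⟨y, hy⟩
    rw [← Finset.sum_subset (Finset.subset_univ S)]
    · refine (Finset.sum_le_card_nsmul _ _ ((b : ℝ) ^ Fintype.card ι) fun s _ => ?_).trans ?_
      · exact_mod_cast (Finset.card_filter_le _ _).trans (card_fiberTuples_le a hb _ hlam0)
      · rw [nsmul_eq_mul]
        have : (S.card : ℝ) ≤ shiftBound a b (Fintype.card ι) := by exact_mod_cast hcard
        gcongr
    · intro s _ hs
      simp only [hS, Finset.mem_filter, Finset.mem_univ, true_and,
        Finset.not_nonempty_iff_eq_empty] at hs
      rw [hs]; simp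
  · rw [nsmul_eq_mul]
    gcongr

theorem moment_le {a b l : ℕ} (ha : 0 < a) (hb : 0 < b) (hl : 0 < l) (𝒱 : Finset (ZMod q)) :
    ∑ lam ∈ Finset.univ.erase (0 : ZMod q), ∑ s : ZMod q,
      ‖∑ v ∈ 𝒱, fiberSum a b lam (s + v)‖ ^ (2 * l) ≤
      (momentConst a b l : ℝ) * ((q : ℝ) ^ 2 * 𝒱.card ^ l + q * 𝒱.card ^ (2 * l)) := by
  set P := Fintype.piFinset fun _ : Fin l ⊕ Fin l => 𝒱 with hP
  set ε : Fin l ⊕ Fin l → ZMod q := Sum.elim 1 (-1) with hε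
  have hε0 : ∀ i, ε i ≠ 0 := by rintro (i | i) <;> simp [hε]
  set E := Finset.univ.erase (0 : ZMod q) with hE
  set cnt : (Fin l ⊕ Fin l → ZMod q) → ℝ := fun v => ∑ s : ZMod q, ∑ lam ∈ E,
    (((fiberTuples a b (fun i => s + v i) lam).filter fun y => ∑ i, ε i * y i = 0).card : ℝ)
    with hcnt
  have h1 : ∑ lam ∈ E, ∑ s : ZMod q, ‖∑ v ∈ 𝒱, fiberSum a b lam (s + v)‖ ^ (2 * l) ≤
      ∑ v ∈ P, cnt v := by
    have h2 : ((∑ lam ∈ E, ∑ s : ZMod q, ‖∑ v ∈ 𝒱, fiberSum a b lam (s + v)‖ ^ (2 * l) : ℝ) : ℂ)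
        = ∑ v ∈ P, ∑ s : ZMod q, ∑ lam ∈ E, ∑ y ∈ fiberTuples a b (fun i => s + v i) lam,
          (ZMod.stdAddChar (∑ i, ε i * y i) : ℂ) := by
      rw [Complex.ofReal_sum, Finset.sum_congr rfl fun lam _ => Complex.ofReal_sum _ _]
      simp_rw [norm_pow_eq_sum]
      rw [Finset.sum_comm, Finset.sum_congr rfl fun s _ => Finset.sum_comm, Finset.sum_comm]
    rw [← Complex.ofReal_re (∑ lam ∈ E, _), h2, Complex.re_sum]
    refine Finset.sum_le_sum fun v _ => ?_
    rw [Complex.re_sum]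
    exact Finset.sum_le_sum fun s _ => re_sum_fiberTuples_le a b _ ε
  refine h1.trans ?_
  rw [← Finset.sum_filter_add_sum_filter_not P (fun v => ∀ i, ∃ j, j ≠ i ∧ v j = v i)]
  have hcι : Fintype.card (Fin l ⊕ Fin l) = 2 * l := by simp [two_mul]
  have hA : ∑ v ∈ P with ∀ i, ∃ j, j ≠ i ∧ v j = v i, cnt v ≤
      (l ^ (2 * l) * 𝒱.card ^ l : ℕ) * ((q : ℝ) ^ 2 * b ^ (2 * l)) := by
    refine (Finset.sum_le_card_nsmul _ _ ((q : ℝ) ^ 2 * b ^ (2 * l)) fun v _ => ?_).trans ?_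
    · simpa only [hcι] using sum_card_filter_le_of_no_unique hb v ε
    · rw [nsmul_eq_mul]
      gcongr
      convert card_piFinset_no_unique_le hl 𝒱
      rfl
  have hB : ∑ v ∈ P with ¬ ∀ i, ∃ j, j ≠ i ∧ v j = v i, cnt v ≤
      (𝒱.card ^ (2 * l) : ℕ) * ((q : ℝ) * (shiftBound a b (2 * l) * b ^ (2 * l))) := by
    refine (Finset.sum_le_card_nsmul _ _
      ((q : ℝ) * (shiftBound a b (2 * l) * b ^ (2 * l))) fun v hv => ?_).trans ?_
    · have := (Finset.mem_filter.1 hv).2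
      push Not at this
      obtain ⟨i₀, hi₀⟩ := this
      simpa only [hcι] using sum_card_filter_le_of_unique ha hb v ε hi₀ (hε0 i₀)
    · rw [nsmul_eq_mul]
      gcongr
      refine (Finset.card_filter_le _ _).trans ?_
      rw [hP, Fintype.card_piFinset]
      simp [two_mul]
  refine (add_le_add hA hB).trans ?_
  have : (momentConst a b l : ℝ) = b ^ (2 * l) * (l ^ (2 * l) + shiftBound a b (2 * l)) := by
    simp [momentConst]
  rw [this]
  push_cast
  have e1 : (0 : ℝ) ≤ b ^ (2 * l) * l ^ (2 * l) * (q * 𝒱.card ^ (2 * l)) := by positivity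
  have e2 : (0 : ℝ) ≤ b ^ (2 * l) * shiftBound a b (2 * l) * (q ^ 2 * 𝒱.card ^ l) := by positivity
  nlinarith [e1, e2]

end Moment

section ShiftedSums

theorem pow_sum_comp_le {τ κ : Type*} (𝒯 : Finset τ) (cells : Finset κ) (φ : τ → κ)
    (hφ : ∀ t ∈ 𝒯, φ t ∈ cells) (F : κ → ℝ) (hF : ∀ k, 0 ≤ F k) {l : ℕ} (hl : 0 < l) :
    (∑ t ∈ 𝒯, F (φ t)) ^ (2 * l) ≤ (𝒯.card : ℝ) ^ (2 * (l - 1)) *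
      ((((𝒯 ×ˢ 𝒯).filter fun p => φ p.1 = φ p.2).card : ℝ) * ∑ k ∈ cells, F k ^ (2 * l)) := by
  set ν : κ → ℝ := fun k => ((𝒯.filter fun t => φ t = k).card : ℝ) with hν
  have h1 : (∑ t ∈ 𝒯, F (φ t)) ^ l ≤ (𝒯.card : ℝ) ^ (l - 1) * ∑ t ∈ 𝒯, F (φ t) ^ l := by
    obtain ⟨n, rfl⟩ : ∃ n, l = n + 1 := ⟨l - 1, by omega⟩
    rcases Finset.eq_empty_or_nonempty 𝒯 with rfl | hne
    · simp
    · have := pow_sum_div_card_le_sum_pow (s := 𝒯) (f := fun t => F (φ t))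
        (fun t _ => hF _) n
      have hc : (0 : ℝ) < (𝒯.card : ℝ) ^ n := by
        have := hne.card_pos
        positivity
      rw [div_le_iff₀ hc] at this
      simpa [mul_comm] using this
  have h2 : ∑ t ∈ 𝒯, F (φ t) ^ l = ∑ k ∈ cells, ν k * F k ^ l := by
    rw [← Finset.sum_fiberwise_of_maps_to hφ]
    refine Finset.sum_congr rfl fun k _ => ?_
    rw [Finset.sum_congr rfl (g := fun _ => F k ^ l), Finset.sum_const, nsmul_eq_mul]
    intro t ht
    rw [(Finset.mem_filter.1 ht).2]
  have h3 : ∑ k ∈ cells, ν k ^ 2 = (((𝒯 ×ˢ 𝒯).filter fun p => φ p.1 = φ p.2).card : ℝ) := by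
    have hmaps : ∀ p ∈ (𝒯 ×ˢ 𝒯).filter (fun p => φ p.1 = φ p.2), φ p.1 ∈ cells := fun p hp =>
      hφ _ (Finset.mem_product.1 (Finset.mem_filter.1 hp).1).1
    rw [Finset.card_eq_sum_card_fiberwise hmaps, Nat.cast_sum]
    refine Finset.sum_congr rfl fun k _ => ?_
    rw [hν, sq, ← Nat.cast_mul, ← Finset.card_product]
    congr 2
    ext p
    simp only [Finset.mem_product, Finset.mem_filter]
    constructor
    · rintro ⟨⟨h1, h2⟩, h3, h4⟩; exact ⟨⟨⟨h1, h3⟩, h2.trans h4.symm⟩, h2⟩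
    · rintro ⟨⟨⟨h1, h3⟩, h2⟩, h4⟩; exact ⟨⟨h1, h4⟩, h3, h2 ▸ h4⟩
  have h4 := Finset.sum_mul_sq_le_sq_mul_sq cells ν (fun k => F k ^ l)
  have h5 : ∀ k, (F k ^ l) ^ 2 = F k ^ (2 * l) := fun k => by rw [← pow_mul, mul_comm]
  simp only [h5, h3] at h4
  rw [← h2] at h4
  calc (∑ t ∈ 𝒯, F (φ t)) ^ (2 * l) = ((∑ t ∈ 𝒯, F (φ t)) ^ l) ^ 2 := by rw [← pow_mul, mul_comm]
    _ ≤ ((𝒯.card : ℝ) ^ (l - 1) * ∑ t ∈ 𝒯, F (φ t) ^ l) ^ 2 :=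
      pow_le_pow_left₀ (pow_nonneg (Finset.sum_nonneg fun _ _ => hF _) _) h1 2
    _ = (𝒯.card : ℝ) ^ (2 * (l - 1)) * (∑ t ∈ 𝒯, F (φ t) ^ l) ^ 2 := by
      rw [mul_pow, ← pow_mul, mul_comm 2]
    _ ≤ _ := by gcongr

theorem norm_sum_shift_sub_le (A : ℕ → ℂ) (β : ℝ) (hA : ∀ x, ‖A x‖ ≤ β) (x₀ N k : ℕ) :
    ‖∑ x ∈ Finset.Ico x₀ (x₀ + N), A (x + k) - ∑ x ∈ Finset.Ico x₀ (x₀ + N), A x‖ ≤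
      2 * β * k := by
  induction k with
  | zero => simp
  | succ k ih =>
    have h : ∑ x ∈ Finset.Ico x₀ (x₀ + N), A (x + (k + 1)) -
        ∑ x ∈ Finset.Ico x₀ (x₀ + N), A (x + k) = A (x₀ + N + k) - A (x₀ + k) := by
      rw [← Finset.sum_sub_distrib]
      have := Finset.sum_Ico_sub (fun x => A (x + k)) (Nat.le_add_right x₀ N)
      rw [← this]
      refine Finset.sum_congr rfl fun x _ => ?_
      congr 2; ring
    have h' : ‖A (x₀ + N + k) - A (x₀ + k)‖ ≤ 2 * β :=
      (norm_sub_le _ _).trans (by linarith [hA (x₀ + N + k), hA (x₀ + k)])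
    rw [← h] at h'
    rw [← sub_add_sub_cancel _ (∑ x ∈ Finset.Ico x₀ (x₀ + N), A (x + k))]
    refine (norm_add_le _ _).trans ?_
    push_cast
    linarith

variable {q : ℕ} [Fact q.Prime]

/-- The exponential sum with frequency `m` over the points of the curve `x ^ a * y ^ b = c` with
first coordinate `x`. -/
noncomputable def curveSum (a b : ℕ) (c m : ZMod q) (x : ℕ) : ℂ :=
  ∑ y : ZMod q with y ^ b * (x : ZMod q) ^ a = c, ZMod.stdAddChar (m * y)

theorem norm_curveSum_le (a : ℕ) {b : ℕ} (hb : 0 < b) {c : ZMod q} (hc : c ≠ 0) (m : ZMod q)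
    (x : ℕ) : ‖curveSum a b c m x‖ ≤ b := by
  refine (norm_sum_le _ _).trans ?_
  simp only [norm_stdAddChar, Finset.sum_const, nsmul_eq_mul, mul_one]
  exact Nat.cast_le.2 (card_fiber_le a hb hc _)

theorem curveSum_add_mul (a b : ℕ) (c : ZMod q) {m : ZMod q} (hm : m ≠ 0) (x v : ℕ) {u : ℕ}
    (hu : (u : ZMod q) ≠ 0) :
    curveSum a b c m (x + u * v) =
      fiberSum a b (c * m ^ b / (u : ZMod q) ^ a) ((x : ZMod q) / u + v) := by
  have key : ∀ y : ZMod q, (m * y) ^ b * ((x : ZMod q) / u + v) ^ a = c * m ^ b / (u : ZMod q) ^ a ↔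
      y ^ b * ((x + u * v : ℕ) : ZMod q) ^ a = c := by
    intro y
    have h1 : ((x + u * v : ℕ) : ZMod q) = u * ((x : ZMod q) / u + v) := by
      push_cast; rw [mul_add, mul_div_cancel₀ _ hu]
    rw [h1, eq_div_iff (pow_ne_zero a hu)]
    generalize (x : ZMod q) / u + v = w
    rw [show (m * y) ^ b * w ^ a * (u : ZMod q) ^ a = y ^ b * (u * w) ^ a * m ^ b by ring]
    exact mul_left_inj' (pow_ne_zero b hm)
  rw [curveSum, fiberSum]
  refine Finset.sum_bij (fun y _ => m * y) ?_ ?_ ?_ ?_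
  · intro y hy
    rw [Finset.mem_filter] at hy ⊢
    exact ⟨Finset.mem_univ _, (key y).2 hy.2⟩
  · intro x _ y _ h; exact mul_left_cancel₀ hm h
  · intro y hy
    rw [Finset.mem_filter] at hy
    refine ⟨m⁻¹ * y, ?_, mul_inv_cancel_left₀ hm y⟩
    rw [Finset.mem_filter]
    refine ⟨Finset.mem_univ _, (key _).1 ?_⟩
    rw [mul_inv_cancel_left₀ hm y]; exact hy.2
  · intro y _; rfl

/-- Averaging incomplete sums over the shifts `u * v` reduces them to the moments of `moment_le`. -/
theorem sum_norm_sum_curveSum_le {a b l : ℕ} (ha : 0 < a) (hb : 0 < b) (hl : 0 < l) {c : ZMod q}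
    (hc : c ≠ 0) (ℋ : Finset (ZMod q)) (hℋ : ∀ m ∈ ℋ, m ≠ 0) (𝒰 : Finset ℕ) (h𝒰 : 𝒰.Nonempty)
    {B : ℕ} (hB : ∀ u ∈ 𝒰, u ≤ B) (hu0 : ∀ u ∈ 𝒰, (u : ZMod q) ≠ 0) {V : ℕ} (hV : 0 < V)
    (hVq : V ≤ q) (x₀ N : ℕ) {E : ℝ} (hE0 : 0 ≤ E)
    (hE : (momentConst a b l : ℝ) * ((q : ℝ) ^ 2 * V ^ l + q * V ^ (2 * l)) *
      (((ℋ ×ˢ 𝒰 ×ˢ Finset.Ico x₀ (x₀ + N)) ×ˢ (ℋ ×ˢ 𝒰 ×ˢ Finset.Ico x₀ (x₀ + N))).filter fun p =>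
        c * p.1.1 ^ b / (p.1.2.1 : ZMod q) ^ a = c * p.2.1 ^ b / (p.2.2.1 : ZMod q) ^ a ∧
        (p.1.2.2 : ZMod q) / p.1.2.1 = (p.2.2.2 : ZMod q) / p.2.2.1).card ≤
      (E * V) ^ (2 * l) * ((ℋ.card : ℝ) * (𝒰.card * N)) ^ 2) :
    ∑ m ∈ ℋ, ‖∑ x ∈ Finset.Ico x₀ (x₀ + N), curveSum a b c m x‖ ≤
      ℋ.card * N * E + 2 * b * ℋ.card * (B * V) := by
  set I := Finset.Ico x₀ (x₀ + N) with hI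
  set 𝒯 := ℋ ×ˢ 𝒰 ×ˢ I with h𝒯
  set φ : ZMod q × ℕ × ℕ → ZMod q × ZMod q := fun t =>
    (c * t.1 ^ b / (t.2.1 : ZMod q) ^ a, (t.2.2 : ZMod q) / t.2.1) with hφ
  set 𝒱 : Finset (ZMod q) := (Finset.range V).image (fun v : ℕ => (v : ZMod q)) with h𝒱
  have hinj : Set.InjOn (fun v : ℕ => (v : ZMod q)) (Finset.range V) := by
    intro v hv w hw h
    rw [Finset.mem_coe, Finset.mem_range] at hv hw
    have := (ZMod.natCast_eq_natCast_iff' v w q).1 h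
    rwa [Nat.mod_eq_of_lt (by omega), Nat.mod_eq_of_lt (by omega)] at this
  have h𝒱card : 𝒱.card = V := by rw [h𝒱, Finset.card_image_of_injOn hinj, Finset.card_range]
  set F : ZMod q × ZMod q → ℝ := fun k => ‖∑ v ∈ 𝒱, fiberSum a b k.1 (k.2 + v)‖ with hF
  have h𝒯card : (𝒯.card : ℝ) = ℋ.card * (𝒰.card * N) := by
    simp [h𝒯, hI, Finset.card_product]
  have hX : ∑ t ∈ 𝒯, F (φ t) ≤ ℋ.card * (𝒰.card * N) * (E * V) := by
    have h1 := pow_sum_comp_le 𝒯 (Finset.univ.erase (0 : ZMod q) ×ˢ (Finset.univ : Finset (ZMod q)))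
      φ (fun t ht => by
        rw [h𝒯, Finset.mem_product, Finset.mem_product] at ht
        simp only [hφ, Finset.mem_product, Finset.mem_erase, Finset.mem_univ, and_true]
        exact div_ne_zero (mul_ne_zero hc (pow_ne_zero b (hℋ _ ht.1)))
          (pow_ne_zero a (hu0 _ ht.2.1))) F (fun _ => norm_nonneg _) hl
    have h2 := moment_le (q := q) ha hb hl 𝒱
    rw [← Finset.sum_product' (f := fun lam s => ‖∑ v ∈ 𝒱, fiberSum a b lam (s + v)‖ ^ (2 * l)),
      h𝒱card] at h2
    have h3 : (∑ t ∈ 𝒯, F (φ t)) ^ (2 * l) ≤ (ℋ.card * (𝒰.card * N) * (E * V)) ^ (2 * l) := by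
      refine h1.trans ?_
      rw [h𝒯card]
      calc _ ≤ ((ℋ.card : ℝ) * (𝒰.card * N)) ^ (2 * (l - 1)) *
            ((((𝒯 ×ˢ 𝒯).filter fun p => φ p.1 = φ p.2).card : ℝ) *
              ((momentConst a b l : ℝ) * ((q : ℝ) ^ 2 * V ^ l + q * V ^ (2 * l)))) := by
            gcongr
        _ ≤ ((ℋ.card : ℝ) * (𝒰.card * N)) ^ (2 * (l - 1)) *
            ((E * V) ^ (2 * l) * ((ℋ.card : ℝ) * (𝒰.card * N)) ^ 2) := by
            refine mul_le_mul_of_nonneg_left ?_ (by positivity)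
            rw [mul_comm]
            refine le_trans (le_of_eq ?_) hE
            congr 3
            ext p
            simp [hφ, Prod.ext_iff]
        _ = _ := by
            rw [mul_pow (_ * _) (E * V), mul_comm ((E * V) ^ (2 * l)), ← mul_assoc, ← pow_add]
            congr 2
            omega
    exact (pow_le_pow_iff_left₀ (Finset.sum_nonneg fun _ _ => norm_nonneg _) (by positivity)
      (by omega)).1 h3
  have hUV : (0 : ℝ) < 𝒰.card * V := by
    have := h𝒰.card_pos
    positivity
  have hm : ∀ m ∈ ℋ, (𝒰.card * V : ℝ) * ‖∑ x ∈ I, curveSum a b c m x‖ ≤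
      ∑ u ∈ 𝒰, ∑ x ∈ I, F (φ (m, u, x)) + 𝒰.card * V * (2 * b * (B * V)) := by
    intro m hm
    have hk : ∀ u ∈ 𝒰, (V : ℝ) * ‖∑ x ∈ I, curveSum a b c m x‖ ≤
        ∑ x ∈ I, F (φ (m, u, x)) + V * (2 * b * (B * V)) := by
      intro u hu
      have h1 : ∀ v ∈ Finset.range V, ‖∑ x ∈ I, curveSum a b c m (x + u * v) -
          ∑ x ∈ I, curveSum a b c m x‖ ≤ 2 * b * (B * V) := by
        intro v hv
        refine (norm_sum_shift_sub_le _ b (norm_curveSum_le a hb hc m) x₀ N (u * v)).trans ?_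
        push_cast
        have h1 : (u : ℝ) ≤ B := by exact_mod_cast hB u hu
        have h2 : (v : ℝ) ≤ V := by exact_mod_cast (Finset.mem_range.1 hv).le
        gcongr
      have h2 : ‖∑ v ∈ Finset.range V, (∑ x ∈ I, curveSum a b c m (x + u * v) -
          ∑ x ∈ I, curveSum a b c m x)‖ ≤ V * (2 * b * (B * V)) := by
        refine (norm_sum_le_of_le _ h1).trans_eq ?_
        simp
      rw [Finset.sum_sub_distrib, Finset.sum_const, Finset.card_range, nsmul_eq_mul] at h2
      have h3 : ‖∑ v ∈ Finset.range V, ∑ x ∈ I, curveSum a b c m (x + u * v)‖ ≤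
          ∑ x ∈ I, F (φ (m, u, x)) := by
        rw [Finset.sum_comm]
        refine norm_sum_le_of_le _ fun x _ => le_of_eq ?_
        simp only [hF, hφ]
        rw [h𝒱, Finset.sum_image hinj]
        congr 1
        exact Finset.sum_congr rfl fun v _ => curveSum_add_mul a b c (hℋ m hm) x v (hu0 u hu)
      have h4 : (V : ℝ) * ‖∑ x ∈ I, curveSum a b c m x‖ =
          ‖(V : ℂ) * ∑ x ∈ I, curveSum a b c m x‖ := by simp
      rw [h4]
      have h5 := norm_sub_norm_le ((V : ℂ) * ∑ x ∈ I, curveSum a b c m x)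
        (∑ v ∈ Finset.range V, ∑ x ∈ I, curveSum a b c m (x + u * v))
      rw [norm_sub_rev] at h5
      linarith
    have h6 := Finset.sum_le_sum hk
    rw [Finset.sum_const, nsmul_eq_mul, Finset.sum_add_distrib, Finset.sum_const,
      nsmul_eq_mul] at h6
    linarith
  have hs := Finset.sum_le_sum hm
  rw [← Finset.mul_sum, Finset.sum_add_distrib, Finset.sum_const, nsmul_eq_mul] at hs
  have h7 : ∑ m ∈ ℋ, ∑ u ∈ 𝒰, ∑ x ∈ I, F (φ (m, u, x)) = ∑ t ∈ 𝒯, F (φ t) := by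
    rw [h𝒯, Finset.sum_product]
    exact Finset.sum_congr rfl fun m _ => by rw [Finset.sum_product]
  rw [h7] at hs
  refine le_of_mul_le_mul_left ?_ hUV
  calc _ ≤ _ := hs
    _ ≤ ℋ.card * (𝒰.card * N) * (E * V) + ℋ.card * (𝒰.card * V * (2 * b * (B * V))) := by gcongr
    _ = _ := by ring

end ShiftedSums

section IncompleteSums

variable {q : ℕ} [Fact q.Prime]

theorem natCast_injOn_zmod_Ico (x₀ N : ℕ) (hN : N ≤ q) :
    Set.InjOn (fun x : ℕ => (x : ZMod q)) (Finset.Ico x₀ (x₀ + N)) := by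
  intro x hx y hy h
  rw [Finset.mem_coe, Finset.mem_Ico] at hx hy
  have h' := (ZMod.natCast_eq_natCast_iff x y q).1 h
  rcases le_total x y with hxy | hxy
  · have := Nat.eq_zero_of_dvd_of_lt ((Nat.modEq_iff_dvd' hxy).1 h') (by omega)
    omega
  · have := Nat.eq_zero_of_dvd_of_lt ((Nat.modEq_iff_dvd' hxy).1 h'.symm) (by omega)
    omega

theorem sum_norm_sum_curveSum_le' {a b l : ℕ} (ha : 0 < a) (hb : 0 < b) (hl : 0 < l) {c : ZMod q}
    (hc : c ≠ 0) (ℋ : Finset (ZMod q)) (hℋ : ∀ m ∈ ℋ, m ≠ 0) (𝒰 : Finset ℕ) (h𝒰 : 𝒰.Nonempty)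
    {B : ℕ} (hB : ∀ u ∈ 𝒰, u ≤ B) (hu0 : ∀ u ∈ 𝒰, (u : ZMod q) ≠ 0) {V D : ℕ} (hV : 0 < V)
    (hVq : V ≤ q) (hD : q ≤ D * V ^ l) (x₀ N : ℕ) {E : ℝ} (hE0 : 0 ≤ E) {Z : ℕ}
    (hZ : (((ℋ ×ˢ 𝒰 ×ˢ Finset.Ico x₀ (x₀ + N)) ×ˢ (ℋ ×ˢ 𝒰 ×ˢ Finset.Ico x₀ (x₀ + N))).filter
        fun p => c * p.1.1 ^ b / (p.1.2.1 : ZMod q) ^ a = c * p.2.1 ^ b / (p.2.2.1 : ZMod q) ^ a ∧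
        (p.1.2.2 : ZMod q) / p.1.2.1 = (p.2.2.2 : ZMod q) / p.2.2.1).card ≤ Z)
    (hE : (momentConst a b l * (D + 1) : ℕ) * (q : ℝ) * Z ≤
      E ^ (2 * l) * ((ℋ.card : ℝ) * (𝒰.card * N)) ^ 2) :
    ∑ m ∈ ℋ, ‖∑ x ∈ Finset.Ico x₀ (x₀ + N), curveSum a b c m x‖ ≤
      ℋ.card * N * E + 2 * b * ℋ.card * (B * V) := by
  refine sum_norm_sum_curveSum_le ha hb hl hc ℋ hℋ 𝒰 h𝒰 hB hu0 hV hVq x₀ N hE0 ?_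
  have hD' : (q : ℝ) ≤ D * V ^ l := by exact_mod_cast hD
  have hZ' := (Nat.cast_le (α := ℝ)).2 hZ
  calc _ ≤ (momentConst a b l : ℝ) * (q * (D * V ^ l) * V ^ l + q * V ^ (2 * l)) * Z := by
        rw [sq]; gcongr
    _ = V ^ (2 * l) * ((momentConst a b l * (D + 1) : ℕ) * (q : ℝ) * Z) := by
        push_cast; ring
    _ ≤ V ^ (2 * l) * (E ^ (2 * l) * ((ℋ.card : ℝ) * (𝒰.card * N)) ^ 2) := by gcongr
    _ = _ := by ring

theorem card_filter_pow_eq_le {b : ℕ} (hb : 0 < b) (t : ZMod q) (S : Finset (ZMod q))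
    (hS : ∀ u ∈ S, u ^ b = t) : S.card ≤ b := by
  refine le_trans (Finset.card_le_card ?_)
    ((Multiset.toFinset_card_le _).trans (Polynomial.card_nthRoots b t))
  intro y hy
  rw [Multiset.mem_toFinset, Polynomial.mem_nthRoots hb]
  exact hS y hy

theorem natCast_zmod_ne_zero {u : ℕ} (hu : 0 < u) (huq : u < q) : (u : ZMod q) ≠ 0 := by
  rw [Ne, ZMod.natCast_eq_zero_iff]
  exact fun h => absurd (Nat.le_of_dvd hu h) (by omega)

/-- A nontrivial bound for incomplete exponential sums on the curve, with a single frequency. -/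
theorem exists_norm_sum_curveSum_le {a b : ℕ} (ha : 0 < a) (hb : 0 < b) (i D : ℕ) (hi : 0 < i) :
    ∃ C : ℝ, 0 < C ∧ ∀ (q : ℕ) [Fact q.Prime] (c m : ZMod q) (R x₀ N : ℕ), c ≠ 0 → m ≠ 0 →
      2 ≤ R → R ^ (50 * i) ≤ q → q ≤ D * R ^ (50 * i) → N ≤ q →
      ‖∑ x ∈ Finset.Ico x₀ (x₀ + N), curveSum a b c m x‖ * R ^ (4 * i) ≤ C * q := by
  set M := momentConst a b 2 * (D + 1) with hM
  set C₁ : ℝ := (M * a : ℕ) + 1 with hC₁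
  have hC₁1 : 1 ≤ C₁ := by rw [hC₁]; linarith [(Nat.cast_nonneg (M * a) : (0 : ℝ) ≤ _)]
  refine ⟨C₁ + 2 * b, by positivity, ?_⟩
  intro q _ c m R x₀ N hc hm hR hRq hqR hNq
  have hRpos : (0 : ℝ) < R := by positivity
  by_cases hN : N * R ^ (4 * i) ≤ q
  · have h1 : ‖∑ x ∈ Finset.Ico x₀ (x₀ + N), curveSum a b c m x‖ ≤ N * b := by
      refine (norm_sum_le_of_le _ fun x _ => norm_curveSum_le a hb hc m x).trans_eq ?_
      simp
    have hN' : (N : ℝ) * R ^ (4 * i) ≤ q := by exact_mod_cast hN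
    calc _ ≤ (N : ℝ) * b * R ^ (4 * i) := by gcongr
      _ = b * (N * R ^ (4 * i)) := by ring
      _ ≤ b * q := by gcongr
      _ ≤ (C₁ + 2 * b) * q := by gcongr; linarith [(Nat.cast_nonneg b : (0 : ℝ) ≤ b)]
  · push Not at hN
    set U := R ^ (20 * i) with hU
    have hUq : U < q := lt_of_lt_of_le (Nat.pow_lt_pow_right (by omega) (by omega)) hRq
    have hVq : R ^ (25 * i) ≤ q := (Nat.pow_le_pow_right (by omega) (by omega)).trans hRq
    have hU0 : 0 < U := by positivity
    have hmem : ∀ u ∈ Finset.Icc 1 U, (u : ZMod q) ≠ 0 := fun u hu => by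
      rw [Finset.mem_Icc] at hu
      exact natCast_zmod_ne_zero (by omega) (by omega)
    have hUinj : Set.InjOn (fun x : ℕ => (x : ZMod q)) (Finset.Icc 1 U) := by
      have := natCast_injOn_zmod_Ico (q := q) 1 U hUq.le
      convert this using 2
      ext; simp; omega
    have key := sum_norm_sum_curveSum_le' (q := q) ha hb (l := 2) (by norm_num) hc {m} (by simpa)
      (Finset.Icc 1 U) (Finset.nonempty_Icc.2 hU0) (B := U) (fun u hu => (Finset.mem_Icc.1 hu).2) hmem
      (V := R ^ (25 * i)) (D := D) (by positivity) hVq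
      (by rw [← pow_mul]; convert hqR using 3; ring) x₀ N (E := C₁ / R ^ (4 * i)) (by positivity)
      (Z := a * (U * N)) ?_ ?_
    · rw [Finset.sum_singleton] at key
      simp only [Finset.card_singleton, Nat.cast_one, one_mul, mul_one] at key
      have h49 : (U : ℝ) * (R ^ (25 * i) : ℕ) * R ^ (4 * i) ≤ q := by
        rw [hU]
        have : R ^ (20 * i) * R ^ (25 * i) * R ^ (4 * i) ≤ q := by
          rw [← pow_add, ← pow_add]
          exact (Nat.pow_le_pow_right (by omega) (by omega)).trans hRq
        exact_mod_cast this
      calc _ ≤ ((N : ℝ) * (C₁ / R ^ (4 * i)) + 2 * b * (U * (R ^ (25 * i) : ℕ))) * R ^ (4 * i) := by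
            gcongr
        _ = C₁ * N + 2 * b * (U * (R ^ (25 * i) : ℕ) * R ^ (4 * i)) := by
            field_simp
        _ ≤ C₁ * q + 2 * b * q := by gcongr
        _ = _ := by ring
    · set T := ({m} : Finset (ZMod q)) ×ˢ Finset.Icc 1 U ×ˢ Finset.Ico x₀ (x₀ + N) with hT
      have hTc : T.card = U * N := by simp [hT]
      have := Finset.card_le_mul_card_image_of_maps_to (f := Prod.snd)
        (s := (T ×ˢ T).filter fun p =>
          c * p.1.1 ^ b / (p.1.2.1 : ZMod q) ^ a = c * p.2.1 ^ b / (p.2.2.1 : ZMod q) ^ a ∧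
          (p.1.2.2 : ZMod q) / p.1.2.1 = (p.2.2.2 : ZMod q) / p.2.2.1) (t := T)
        (fun p hp => (Finset.mem_product.1 (Finset.mem_filter.1 hp).1).2) a ?_
      · rwa [hTc] at this
      · rintro ⟨m', u', x'⟩ ht'
        simp only [hT, Finset.mem_product, Finset.mem_singleton] at ht'
        obtain ⟨rfl, hu', hx'⟩ := ht'
        have hinj : Set.InjOn (fun p : (ZMod q × ℕ × ℕ) × (ZMod q × ℕ × ℕ) => (p.1.2.1 : ZMod q))
            (((T ×ˢ T).filter fun p =>
          c * p.1.1 ^ b / (p.1.2.1 : ZMod q) ^ a = c * p.2.1 ^ b / (p.2.2.1 : ZMod q) ^ a ∧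
          (p.1.2.2 : ZMod q) / p.1.2.1 = (p.2.2.2 : ZMod q) / p.2.2.1).filter
            fun p => p.2 = (m', u', x')) := by
          rintro ⟨⟨m₁, u₁, x₁⟩, t₁⟩ h₁ ⟨⟨m₂, u₂, x₂⟩, t₂⟩ h₂ h
          simp only [hT, Finset.coe_filter, Finset.mem_filter, Finset.mem_product,
            Finset.mem_singleton, Set.mem_ofPred_eq] at h₁ h₂
          obtain ⟨⟨⟨⟨rfl, hu₁, hx₁⟩, -⟩, -, e₁⟩, rfl⟩ := h₁
          obtain ⟨⟨⟨⟨rfl, hu₂, hx₂⟩, -⟩, -, e₂⟩, rfl⟩ := h₂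
          have hu : u₁ = u₂ := hUinj hu₁ hu₂ h
          subst hu
          have hx : x₁ = x₂ := by
            refine natCast_injOn_zmod_Ico x₀ N hNq hx₁ hx₂ ?_
            have := e₁.trans e₂.symm
            exact (div_left_inj' (hmem _ hu₁)).1 this
          rw [hx]
        rw [← Finset.card_image_of_injOn hinj]
        refine card_filter_pow_eq_le ha ((u' : ZMod q) ^ a) _ fun z hz => ?_
        obtain ⟨⟨⟨m₁, u₁, x₁⟩, t₁⟩, h₁, rfl⟩ := Finset.mem_image.1 hz
        simp only [hT, Finset.mem_filter, Finset.mem_product, Finset.mem_singleton] at h₁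
        obtain ⟨⟨⟨⟨rfl, hu₁, hx₁⟩, -⟩, e₁, -⟩, rfl⟩ := h₁
        have h1 := pow_ne_zero a (hmem _ hu₁)
        have h2 := pow_ne_zero a (hmem _ hu')
        have h3 : c * m₁ ^ b ≠ 0 := mul_ne_zero hc (pow_ne_zero b hm)
        rw [div_eq_div_iff h1 h2] at e₁
        exact (mul_left_cancel₀ h3 e₁).symm
    · have hN' : (q : ℝ) ≤ N * R ^ (4 * i) := by exact_mod_cast hN.le
      have hMa : ((M * a : ℕ) : ℝ) ≤ C₁ ^ 4 := by
        calc ((M * a : ℕ) : ℝ) ≤ C₁ := by rw [hC₁]; linarith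
          _ ≤ C₁ ^ 4 := le_self_pow₀ hC₁1 (by norm_num)
      have hUR : (U : ℝ) = R ^ (20 * i) := by rw [hU]; push_cast; rfl
      simp only [Finset.card_singleton, Nat.cast_one, one_mul, Nat.card_Icc, Nat.add_sub_cancel]
      have e1 : (C₁ / (R : ℝ) ^ (4 * i)) ^ (2 * 2) * (U * N) ^ 2 =
          C₁ ^ 4 * (N * R ^ (4 * i)) * (U * N) := by
        rw [div_pow, hUR]
        have : (R : ℝ) ^ (20 * i) = R ^ (4 * i) * ((R : ℝ) ^ (4 * i)) ^ 4 := by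
          rw [← pow_mul, ← pow_add]; congr 1; ring
        rw [show 2 * 2 = 4 from rfl, this]
        field_simp
      rw [e1]
      push_cast at hMa ⊢
      calc _ = ((M : ℝ) * a) * q * (U * N) := by push_cast [hM]; ring
        _ ≤ _ := by gcongr

end IncompleteSums

section BoxCount

theorem card_filter_mul_eq_mul_le {W N : ℕ} (hW : 0 < W) :
    (((Finset.Ico (W ^ 2) (W ^ 2 + W) ×ˢ Finset.Ico 1 (1 + N)) ×ˢ
      (Finset.Ico (W ^ 2) (W ^ 2 + W) ×ˢ Finset.Ico 1 (1 + N))).filter fun p =>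
        p.1.2 * p.2.1 = p.2.2 * p.1.1).card ≤ 2 * W * N := by
  set 𝒰 := Finset.Ico (W ^ 2) (W ^ 2 + W) with h𝒰
  set I := Finset.Ico 1 (1 + N) with hI
  set Q := ((𝒰 ×ˢ I) ×ˢ (𝒰 ×ˢ I)).filter fun p => p.1.2 * p.2.1 = p.2.2 * p.1.1 with hQ
  have h𝒰c : 𝒰.card = W := by simp [h𝒰]
  have hpos : ∀ u ∈ 𝒰, 0 < u := fun u hu => by
    have := (Finset.mem_Ico.1 hu).1
    have : 0 < W ^ 2 := by positivity
    omega
  have hfib : ∀ t ∈ 𝒰 ×ˢ 𝒰, (Q.filter fun p => (p.1.1, p.2.1) = t).card ≤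
      (I.filter fun x => t.1 ∣ x * t.2).card := by
    rintro ⟨u, u'⟩ ht
    refine Finset.card_le_card_of_injOn (fun p => p.1.2) ?_ ?_
    · rintro ⟨⟨u₁, x₁⟩, ⟨u₂, x₂⟩⟩ hp
      simp only [hQ, Finset.coe_filter, Finset.mem_filter, Finset.mem_product, Set.mem_ofPred_eq,
        Prod.mk.injEq] at hp ⊢
      obtain ⟨⟨⟨⟨-, hx₁⟩, -, -⟩, h⟩, rfl, rfl⟩ := hp
      exact ⟨hx₁, h ▸ dvd_mul_left _ _⟩
    · rintro ⟨⟨u₁, x₁⟩, ⟨u₂, x₂⟩⟩ hp ⟨⟨u₃, x₃⟩, ⟨u₄, x₄⟩⟩ hp' h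
      simp only [hQ, Finset.coe_filter, Finset.mem_filter, Finset.mem_product, Set.mem_ofPred_eq,
        Prod.mk.injEq] at hp hp' h
      obtain ⟨⟨⟨⟨hu, -⟩, -, -⟩, h1⟩, rfl, rfl⟩ := hp
      obtain ⟨⟨-, h2⟩, rfl, rfl⟩ := hp'
      subst h
      have : x₂ = x₄ := Nat.eq_of_mul_eq_mul_right (hpos _ hu) (h1.symm.trans h2)
      rw [this]
  have hcount : ∀ t ∈ 𝒰 ×ˢ 𝒰, (I.filter fun x => t.1 ∣ x * t.2).card * W ≤
      if t.1 = t.2 then N * W else N := by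
    rintro ⟨u, u'⟩ ht
    obtain ⟨hu, hu'⟩ := Finset.mem_product.1 ht
    split_ifs with h
    · exact Nat.mul_le_mul_right _ ((Finset.card_filter_le _ _).trans (by simp [hI]))
    · simp only at h hu hu'
      set g := Nat.gcd u u' with hg
      have hu0 := hpos u hu
      have hg0 : 0 < g := Nat.gcd_pos_of_pos_left _ hu0
      have hgW : g ≤ W := by
        rw [h𝒰, Finset.mem_Ico] at hu hu'
        rcases Nat.lt_or_gt_of_ne h with h' | h'
        · have : g ∣ u' - u := Nat.dvd_sub (Nat.gcd_dvd_right _ _) (Nat.gcd_dvd_left _ _)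
          exact (Nat.le_of_dvd (by omega) this).trans (by omega)
        · have : g ∣ u - u' := Nat.dvd_sub (Nat.gcd_dvd_left _ _) (Nat.gcd_dvd_right _ _)
          exact (Nat.le_of_dvd (by omega) this).trans (by omega)
      have hsub : I.filter (fun x => u ∣ x * u') ⊆ (Finset.Ioc 0 N).filter (fun x => u / g ∣ x) := by
        intro x hx
        simp only [hI, Finset.mem_filter, Finset.mem_Ico, Finset.mem_Ioc] at hx ⊢
        refine ⟨by omega, ?_⟩
        have h1 : u / g ∣ x * (u' / g) := by
          rw [← Nat.mul_div_assoc _ (Nat.gcd_dvd_right u u')]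
          exact Nat.div_dvd_div (Nat.gcd_dvd_left u u') hx.2
        exact (Nat.coprime_div_gcd_div_gcd hg0).dvd_of_dvd_mul_right h1
      have h1 := Finset.card_le_card hsub
      rw [Nat.Ioc_filter_dvd_card_eq_div] at h1
      have h2 : N / (u / g) * (u / g) ≤ N := Nat.div_mul_le_self _ _
      have h3 : u / g * g = u := Nat.div_mul_cancel (Nat.gcd_dvd_left u u')
      have h4 : W * W ≤ u := by rw [← sq]; exact (Finset.mem_Ico.1 hu).1
      have h5 : W ≤ u / g := by
        by_contra hlt
        push Not at hlt
        have : u / g * g < W * W := by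
          calc u / g * g ≤ u / g * W := Nat.mul_le_mul_left _ hgW
            _ < W * W := Nat.mul_lt_mul_of_pos_right hlt hW
        omega
      calc _ ≤ N / (u / g) * (u / g) := Nat.mul_le_mul h1 h5
        _ ≤ N := h2
  have hmaps : ∀ p ∈ Q, (p.1.1, p.2.1) ∈ 𝒰 ×ˢ 𝒰 := fun p hp => by
    simp only [hQ, Finset.mem_filter, Finset.mem_product] at hp ⊢
    exact ⟨hp.1.1.1, hp.1.2.1⟩
  have hQc : Q.card * W ≤ 2 * W * N * W := by
    rw [Finset.card_eq_sum_card_fiberwise hmaps, Finset.sum_mul]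
    calc _ ≤ ∑ t ∈ 𝒰 ×ˢ 𝒰, if t.1 = t.2 then N * W else N :=
          Finset.sum_le_sum fun t ht => (Nat.mul_le_mul_right _ (hfib t ht)).trans (hcount t ht)
      _ ≤ ∑ t ∈ 𝒰 ×ˢ 𝒰, ((if t.1 = t.2 then N * W else 0) + N) := by
          refine Finset.sum_le_sum fun t _ => ?_
          split_ifs <;> omega
      _ = W * (N * W) + W * W * N := by
          rw [Finset.sum_add_distrib, Finset.sum_product]
          simp only [Finset.sum_ite_eq, Finset.sum_const, Finset.card_product, h𝒰c, smul_eq_mul]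
          rw [Finset.sum_congr rfl (g := fun _ => N * W) fun u hu => by rw [if_pos hu],
            Finset.sum_const, h𝒰c, smul_eq_mul]
      _ = _ := by ring
  exact Nat.le_of_mul_le_mul_right hQc hW

variable {q : ℕ} [Fact q.Prime]

theorem half_le_re_stdAddChar {j : ℕ} (hj : 8 * j ≤ q) :
    1 / 2 ≤ (ZMod.stdAddChar ((j : ℕ) : ZMod q) : ℂ).re := by
  have hq : (0 : ℝ) < q := by exact_mod_cast (Fact.out : q.Prime).pos
  have h1 := ZMod.stdAddChar_coe (N := q) (j : ℤ)
  rw [Int.cast_natCast] at h1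
  have h2 : 2 * (π : ℂ) * Complex.I * ((j : ℤ) : ℂ) / q = ((2 * π * j / q : ℝ) : ℂ) * Complex.I := by
    push_cast; ring
  rw [h1, h2, Complex.exp_ofReal_mul_I_re]
  have h3 := Real.one_sub_sq_div_two_le_cos (x := 2 * π * j / q)
  have h4 : 2 * π * j / q ≤ 1 := by
    rw [div_le_one hq]
    have h5 : (8 : ℝ) * j ≤ q := by exact_mod_cast hj
    nlinarith [Real.pi_le_four, (Nat.cast_nonneg j : (0 : ℝ) ≤ j)]
  have h6 : 0 ≤ 2 * π * j / q := by positivity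
  nlinarith

theorem half_le_norm_sum_stdAddChar {H y : ℕ} (hy : 8 * (H * y) ≤ q) :
    (H : ℝ) / 2 ≤ ‖∑ k ∈ Finset.range H, (ZMod.stdAddChar ((k : ZMod q) * (y : ZMod q)) : ℂ)‖ := by
  refine le_trans ?_ (Complex.re_le_norm _)
  rw [Complex.re_sum]
  have := Finset.card_nsmul_le_sum (Finset.range H)
    (fun k => (ZMod.stdAddChar ((k : ZMod q) * (y : ZMod q)) : ℂ).re) (1 / 2) fun k hk => by
      rw [← Nat.cast_mul]
      refine half_le_re_stdAddChar (le_trans ?_ hy)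
      have := (Finset.mem_range.1 hk).le
      gcongr
  rw [Finset.card_range, nsmul_eq_mul] at this
  linarith

/-- The points of the curve `x ^ a * y ^ b = c` in the box `[1, N]²`. -/
noncomputable def boxPoints (a b : ℕ) (c : ZMod q) (N : ℕ) : Finset (ℕ × ℕ) :=
  (Finset.Ico 1 (1 + N) ×ˢ Finset.Ico 1 (1 + N)).filter
    fun p => (p.2 : ZMod q) ^ b * (p.1 : ZMod q) ^ a = c

theorem card_boxPoints_mul_le {a b : ℕ} (c : ZMod q) {N H : ℕ}
    (hH : 8 * (H * N) ≤ q) (hNq : N ≤ q) :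
    ((boxPoints a b c N).card : ℝ) * (H / 2) ^ 2 ≤ ∑ k' ∈ Finset.range H, ∑ k ∈ Finset.range H,
      ‖∑ x ∈ Finset.Ico 1 (1 + N), curveSum a b c ((k : ZMod q) - k') x‖ := by
  set I := Finset.Ico 1 (1 + N) with hI
  set f : ZMod q → ℝ := fun y => ‖∑ k ∈ Finset.range H, (ZMod.stdAddChar ((k : ZMod q) * y) : ℂ)‖
    with hf
  have h1 : ((boxPoints a b c N).card : ℝ) * (H / 2) ^ 2 ≤
      ∑ x ∈ I, ∑ y : ZMod q with y ^ b * (x : ZMod q) ^ a = c, f y ^ 2 := by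
    rw [boxPoints, Finset.card_filter, Nat.cast_sum, Finset.sum_mul, Finset.sum_product]
    refine Finset.sum_le_sum fun x _ => ?_
    have hinj := natCast_injOn_zmod_Ico (q := q) 1 N hNq
    have h2 : ∑ y ∈ (I.image fun y : ℕ => (y : ZMod q)) with y ^ b * (x : ZMod q) ^ a = c, f y ^ 2 ≤
        ∑ y : ZMod q with y ^ b * (x : ZMod q) ^ a = c, f y ^ 2 :=
      Finset.sum_le_sum_of_subset_of_nonneg (Finset.filter_subset_filter _ (Finset.subset_univ _))
        fun _ _ _ => by positivity
    refine le_trans ?_ h2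
    rw [Finset.sum_filter, Finset.sum_image hinj]
    refine Finset.sum_le_sum fun y hy => ?_
    split_ifs
    · rw [Nat.cast_one, one_mul]
      refine pow_le_pow_left₀ (by positivity) (half_le_norm_sum_stdAddChar (le_trans ?_ hH)) 2
      rw [Finset.mem_Ico] at hy
      have : y ≤ N := by omega
      gcongr
    · simp
  have h3 : ((∑ x ∈ I, ∑ y : ZMod q with y ^ b * (x : ZMod q) ^ a = c, f y ^ 2 : ℝ) : ℂ) =
      ∑ k' ∈ Finset.range H, ∑ k ∈ Finset.range H,
        ∑ x ∈ I, curveSum a b c ((k : ZMod q) - k') x := by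
    have h4 : ∀ y : ZMod q, ((f y ^ 2 : ℝ) : ℂ) = ∑ k' ∈ Finset.range H, ∑ k ∈ Finset.range H,
        (ZMod.stdAddChar (((k : ZMod q) - (k' : ZMod q)) * y) : ℂ) := by
      intro y
      rw [← Complex.normSq_eq_norm_sq, ← Complex.mul_conj, map_sum, Finset.sum_mul_sum,
        Finset.sum_comm]
      refine Finset.sum_congr rfl fun k' _ => Finset.sum_congr rfl fun k _ => ?_
      rw [← AddChar.map_neg_eq_conj, ← AddChar.map_add_eq_mul]
      congr 1; ring
    rw [Complex.ofReal_sum]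
    simp_rw [Complex.ofReal_sum, h4, curveSum]
    rw [Finset.sum_congr rfl fun x _ => Finset.sum_comm, Finset.sum_comm]
    refine Finset.sum_congr rfl fun k' _ => ?_
    rw [Finset.sum_congr rfl fun x _ => Finset.sum_comm, Finset.sum_comm]
  refine h1.trans ?_
  have h5 : 0 ≤ ∑ x ∈ I, ∑ y : ZMod q with y ^ b * (x : ZMod q) ^ a = c, f y ^ 2 :=
    Finset.sum_nonneg fun _ _ => Finset.sum_nonneg fun _ _ => by positivity
  rw [← Complex.norm_of_nonneg h5, h3]
  exact norm_sum_le_of_le _ fun k' _ => norm_sum_le _ _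

/-- A mean value bound over frequencies for the incomplete sums over `[1, N]`. -/
theorem sum_norm_sum_curveSum_initial_le {a b l D : ℕ} (ha : 0 < a) (hb : 0 < b) (hl : 0 < l)
    {c : ZMod q} (hc : c ≠ 0) (ℋ : Finset (ZMod q)) (hℋ : ∀ m ∈ ℋ, m ≠ 0) {R V N : ℕ}
    (hR : 0 < R) (hV : 0 < V) (hVq : V ≤ q) (hD : q ≤ D * V ^ l) (hℋN : q ≤ 32 * (ℋ.card * N))
    (hN0 : 0 < N) (hN : 2 * (N * R ^ (4 * l)) < q) :
    (∑ m ∈ ℋ, ‖∑ x ∈ Finset.Ico 1 (1 + N), curveSum a b c m x‖) * R ≤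
      ℋ.card * ((64 * b * (momentConst a b l * (D + 1)) + 1 : ℕ) * N +
        4 * b * (R ^ (4 * l) * V * R)) := by
  set W := R ^ (2 * l) with hW
  have hW0 : 0 < W := by positivity
  have hWW : W ^ 2 = R ^ (4 * l) := by rw [hW, ← pow_mul]; congr 1; ring
  have hWle : W ≤ W ^ 2 := Nat.le_self_pow (by norm_num) W
  set 𝒰 := Finset.Ico (W ^ 2) (W ^ 2 + W) with h𝒰
  set I := Finset.Ico 1 (1 + N) with hI
  set C₁ : ℕ := 64 * b * (momentConst a b l * (D + 1)) + 1 with hC₁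
  have hWN : W ^ 2 ≤ N * R ^ (4 * l) := by rw [hWW]; exact Nat.le_mul_of_pos_left _ hN0
  have hmem : ∀ u ∈ 𝒰, (u : ZMod q) ≠ 0 := fun u hu => by
    rw [h𝒰, Finset.mem_Ico] at hu
    have : 0 < W ^ 2 := by positivity
    exact natCast_zmod_ne_zero (by omega) (by omega)
  have key := sum_norm_sum_curveSum_le' (q := q) ha hb hl hc ℋ hℋ 𝒰
    (Finset.nonempty_Ico.2 (by omega)) (B := 2 * W ^ 2)
    (fun u hu => by have := (Finset.mem_Ico.1 hu).2; omega) hmem hV hVq hD 1 N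
    (E := C₁ / R) (by positivity) (Z := b * (ℋ.card * (2 * W * N))) ?_ ?_
  · have hR' : (0 : ℝ) < R := by exact_mod_cast hR
    calc _ ≤ ((ℋ.card : ℝ) * N * (C₁ / R) + 2 * b * ℋ.card * ((2 * W ^ 2 : ℕ) * V)) * R := by gcongr
      _ = ℋ.card * (C₁ * N + 4 * b * ((W ^ 2 : ℕ) * V * R)) := by
        push_cast; field_simp; ring
      _ = _ := by rw [hWW]; push_cast; rfl
  · set Q := (((𝒰 ×ˢ I) ×ˢ (𝒰 ×ˢ I)).filter fun p => p.1.2 * p.2.1 = p.2.2 * p.1.1) with hQ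
    have hQc : Q.card ≤ 2 * W * N := card_filter_mul_eq_mul_le hW0
    set T := ℋ ×ˢ 𝒰 ×ˢ I with hT
    have := Finset.card_le_mul_card_image_of_maps_to (f := fun p => (p.2.1, p.1.2, p.2.2))
      (s := (T ×ˢ T).filter fun p =>
        c * p.1.1 ^ b / (p.1.2.1 : ZMod q) ^ a = c * p.2.1 ^ b / (p.2.2.1 : ZMod q) ^ a ∧
        (p.1.2.2 : ZMod q) / p.1.2.1 = (p.2.2.2 : ZMod q) / p.2.2.1) (t := ℋ ×ˢ Q) ?_ b ?_
    · refine this.trans ?_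
      rw [Finset.card_product]
      gcongr
    · rintro ⟨⟨m, u, x⟩, ⟨m', u', x'⟩⟩ hp
      simp only [hT, hQ, Finset.mem_filter, Finset.mem_product] at hp ⊢
      obtain ⟨⟨⟨hm, hu, hx⟩, hm', hu', hx'⟩, -, h⟩ := hp
      refine ⟨hm', ⟨⟨hu, hx⟩, hu', hx'⟩, ?_⟩
      rw [div_eq_div_iff (hmem u hu) (hmem u' hu'), ← Nat.cast_mul, ← Nat.cast_mul,
        ZMod.natCast_eq_natCast_iff'] at h
      have hlt : ∀ x ∈ I, ∀ u ∈ 𝒰, x * u < q := by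
        intro x hx u hu
        rw [hI, Finset.mem_Ico] at hx
        rw [h𝒰, Finset.mem_Ico] at hu
        calc x * u ≤ N * (2 * W ^ 2) := Nat.mul_le_mul (by omega) (by omega)
          _ < q := by rw [hWW]; linarith
      rwa [Nat.mod_eq_of_lt (hlt _ hx _ hu'), Nat.mod_eq_of_lt (hlt _ hx' _ hu)] at h
    · rintro ⟨m', ⟨u, x⟩, ⟨u', x'⟩⟩ ht
      simp only [hQ, Finset.mem_filter, Finset.mem_product] at ht
      obtain ⟨hm', ⟨⟨hu, hx⟩, hu', hx'⟩, -⟩ := ht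
      set S := ((T ×ˢ T).filter fun p =>
        c * p.1.1 ^ b / (p.1.2.1 : ZMod q) ^ a = c * p.2.1 ^ b / (p.2.2.1 : ZMod q) ^ a ∧
        (p.1.2.2 : ZMod q) / p.1.2.1 = (p.2.2.2 : ZMod q) / p.2.2.1).filter
          fun p => (p.2.1, p.1.2, p.2.2) = (m', (u, x), (u', x')) with hS
      have hinj : Set.InjOn (fun p : (ZMod q × ℕ × ℕ) × (ZMod q × ℕ × ℕ) => p.1.1) S := by
        rintro ⟨⟨m₁, u₁, x₁⟩, ⟨m₂, u₂, x₂⟩⟩ h₁ ⟨⟨m₃, u₃, x₃⟩, ⟨m₄, u₄, x₄⟩⟩ h₂ h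
        simp only [hS, Finset.coe_filter, Set.mem_ofPred_eq, Prod.mk.injEq] at h₁ h₂ h ⊢
        obtain ⟨-, rfl, ⟨rfl, rfl⟩, rfl, rfl⟩ := h₁
        obtain ⟨-, rfl, ⟨rfl, rfl⟩, rfl, rfl⟩ := h₂
        simp [h]
      rw [← Finset.card_image_of_injOn hinj]
      refine card_filter_pow_eq_le hb (m' ^ b / (u' : ZMod q) ^ a * (u : ZMod q) ^ a) _
        fun z hz => ?_
      obtain ⟨⟨⟨m₁, u₁, x₁⟩, ⟨m₂, u₂, x₂⟩⟩, h₁, rfl⟩ := Finset.mem_image.1 hz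
      simp only [hS, Finset.mem_filter, Prod.mk.injEq] at h₁
      obtain ⟨⟨-, e₁, -⟩, rfl, ⟨rfl, rfl⟩, rfl, rfl⟩ := h₁
      have h1 := pow_ne_zero a (hmem _ hu)
      rw [mul_div_assoc, mul_div_assoc] at e₁
      rw [← mul_left_cancel₀ hc e₁, div_mul_cancel₀ _ h1]
  · have hR' : (R : ℝ) ≠ 0 := by exact_mod_cast hR.ne'
    have h𝒰c : 𝒰.card = W := by simp [h𝒰]
    have e1 : (C₁ / (R : ℝ)) ^ (2 * l) * W = C₁ ^ (2 * l) := by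
      rw [div_pow, hW]; push_cast; field_simp
    have e2 : (C₁ : ℝ) ≤ C₁ ^ (2 * l) := by
      exact_mod_cast Nat.le_self_pow (by omega) C₁
    have e3 : (64 * b * (momentConst a b l * (D + 1)) : ℕ) ≤ (C₁ : ℝ) := by
      rw [hC₁]; exact_mod_cast Nat.le_succ _
    have e4 : (q : ℝ) ≤ 32 * (ℋ.card * N) := by exact_mod_cast hℋN
    rw [h𝒰c]
    calc _ ≤ (momentConst a b l * (D + 1) : ℕ) * ((32 : ℝ) * (ℋ.card * N)) *
          (b * (ℋ.card * (2 * W * N)) : ℕ) := by gcongr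
      _ = (64 * b * (momentConst a b l * (D + 1)) : ℕ) * (W * (ℋ.card * N) ^ 2 : ℝ) := by
        push_cast; ring
      _ ≤ (C₁ : ℝ) ^ (2 * l) * (W * (ℋ.card * N) ^ 2 : ℝ) := by
        gcongr; exact e3.trans e2
      _ = _ := by rw [← e1]; ring

/-- A nontrivial bound for the number of points of the curve in a box. -/
theorem exists_card_boxPoints_le {a b l : ℕ} (ha : 0 < a) (hb : 0 < b) (hl : 0 < l) (D : ℕ) :
    ∃ C : ℕ, 0 < C ∧ ∀ (q : ℕ) [Fact q.Prime] (c : ZMod q) (R V N : ℕ), c ≠ 0 → 2 ≤ R → 0 < V →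
      V ≤ q → q ≤ D * V ^ l → R ^ (4 * l) * V * R ≤ N → 16 * (N * R ^ (4 * l)) ≤ q →
      (boxPoints a b c N).card * R ≤ C * N := by
  set C₁ : ℕ := 64 * b * (momentConst a b l * (D + 1)) + 1 with hC₁
  refine ⟨4 * (5 * b + C₁), by positivity, ?_⟩
  intro q _ c R V N hc hR hV hVq hD hUV hNq
  have hN0 : 0 < N := lt_of_lt_of_le (by positivity) hUV
  have hRl : R ≤ R ^ (4 * l) := Nat.le_self_pow (by omega) R
  have hRl0 : 0 < N * R ^ (4 * l) := by positivity
  have hNR : N * R ≤ N * R ^ (4 * l) := Nat.mul_le_mul_left _ hRl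
  have hN2 : N * 2 ≤ N * R := Nat.mul_le_mul_left _ hR
  set H := q / (8 * N) with hH
  have hHle : H * (8 * N) ≤ q := Nat.div_mul_le_self _ _
  have hHlt : q < (H + 1) * (8 * N) := by
    rw [hH, mul_comm]; exact Nat.lt_mul_div_succ q (by omega)
  have hHR : 2 * R ≤ H := by
    rw [hH, Nat.le_div_iff_mul_le (by omega)]
    calc 2 * R * (8 * N) = 16 * (N * R) := by ring
      _ ≤ q := by omega
  have hHq : H ≤ q := Nat.div_le_self _ _
  have hcard := card_boxPoints_mul_le (a := a) (b := b) c (N := N) (H := H)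
    (by linarith) (by omega)
  have hk' : ∀ k' ∈ Finset.range H, (∑ k ∈ Finset.range H,
      ‖∑ x ∈ Finset.Ico 1 (1 + N), curveSum a b c ((k : ZMod q) - (k' : ZMod q)) x‖) * R ≤
      H * ((5 * b + C₁ : ℕ) * N) := by
    intro k' hk'
    have hinj : Set.InjOn (fun k : ℕ => (k : ZMod q) - (k' : ZMod q))
        ((Finset.range H).erase k') := by
      intro x hx y hy h
      have hinj := natCast_injOn_zmod_Ico (q := q) 0 H hHq
      simp only [Finset.coe_erase, Set.mem_sdiff, Finset.mem_coe, Finset.mem_range] at hx hy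
      exact hinj (by simp [hx.1]) (by simp [hy.1]) (sub_left_injective h)
    set ℋ := ((Finset.range H).erase k').image fun k : ℕ => (k : ZMod q) - (k' : ZMod q) with hℋ
    have hℋc : ℋ.card = H - 1 := by
      rw [hℋ, Finset.card_image_of_injOn hinj, Finset.card_erase_of_mem hk', Finset.card_range]
    have hℋ0 : ∀ m ∈ ℋ, m ≠ 0 := by
      intro m hm
      obtain ⟨k, hk, rfl⟩ := Finset.mem_image.1 hm
      rw [sub_ne_zero]
      intro h
      have hinj := natCast_injOn_zmod_Ico (q := q) 0 H hHq
      have hk2 := Finset.mem_of_mem_erase hk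
      rw [Finset.mem_range] at hk2 hk'
      exact Finset.ne_of_mem_erase hk (hinj (by simp [hk2]) (by simp [hk']) h)
    have key := sum_norm_sum_curveSum_initial_le (q := q) ha hb hl hc ℋ hℋ0 (R := R) (V := V)
      (N := N) (D := D) (by omega) hV hVq hD ?_ hN0 (by omega)
    · rw [hℋ, Finset.sum_image hinj, ← hℋ, hℋc] at key
      rw [← Finset.add_sum_erase _ _ hk', sub_self, add_mul]
      have h0 : ‖∑ x ∈ Finset.Ico 1 (1 + N), curveSum a b c 0 x‖ ≤ N * b := by
        refine (norm_sum_le_of_le _ fun x _ => norm_curveSum_le a hb hc 0 x).trans_eq ?_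
        simp
      have hRH : (R : ℝ) ≤ H := by exact_mod_cast (by omega : R ≤ H)
      have hH1 : ((H - 1 : ℕ) : ℝ) ≤ H := by exact_mod_cast Nat.sub_le _ _
      have hUV' : (R : ℝ) ^ (4 * l) * V * R ≤ N := by exact_mod_cast hUV
      calc _ ≤ (N : ℝ) * b * H + H * (C₁ * N + 4 * b * N) := by
            refine add_le_add (by gcongr) (key.trans ?_)
            gcongr
        _ = _ := by push_cast; ring
    · rw [hℋc]
      obtain ⟨h, hh⟩ : ∃ h, H = h + 2 := ⟨H - 2, by omega⟩
      have e : H - 1 = h + 1 := by omega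
      rw [hh] at hHlt
      rw [e]
      have : 0 ≤ h * N := by positivity
      nlinarith
  have hsum := Finset.sum_le_sum hk'
  rw [← Finset.sum_mul, Finset.sum_const, Finset.card_range, nsmul_eq_mul] at hsum
  have hHpos : (0 : ℝ) < H := by exact_mod_cast (by omega : 0 < H)
  have h1 : ((boxPoints a b c N).card : ℝ) * (H / 2) ^ 2 * R ≤
      H * (H * ((5 * b + C₁ : ℕ) * N)) := le_trans (by gcongr) hsum
  have h2 : ((boxPoints a b c N).card * R : ℝ) ≤ 4 * (5 * b + C₁ : ℕ) * N := by
    have h3 : (0 : ℝ) < (H / 2) ^ 2 := by positivity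
    refine le_of_mul_le_mul_right ?_ h3
    calc _ = ((boxPoints a b c N).card : ℝ) * (H / 2) ^ 2 * R := by ring
      _ ≤ _ := h1
      _ = _ := by ring
  exact_mod_cast h2

end BoxCount

section Hurwitz

open Filter Topology HurwitzZeta

theorem hasDerivAt_add_cpow {x : ℝ} (hx : 0 < x) {t : ℝ} (ht : 0 ≤ t) (s : ℂ) :
    HasDerivAt (fun t : ℝ => ((t + x : ℝ) : ℂ) ^ s) (s * ((t + x : ℝ) : ℂ) ^ (s - 1)) t := by
  have h1 : HasDerivAt (fun t : ℝ => ((t + x : ℝ) : ℂ)) 1 t := by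
    simpa using ((hasDerivAt_id t).add_const x).ofReal_comp
  have h2 : ((t + x : ℝ) : ℂ) ∈ Complex.slitPlane := by
    rw [Complex.ofReal_mem_slitPlane]; linarith
  have h3 := ((hasDerivAt_id ((t + x : ℝ) : ℂ)).cpow_const (c := s) h2).comp t h1
  simpa [Function.comp_def] using h3

theorem norm_cpow_neg_sub_le {x : ℝ} (hx : 0 < x) {t : ℝ} (ht : 0 ≤ t) (ht1 : t ≤ 1) {s : ℂ}
    (hs : 0 < s.re) : ‖((t + x : ℝ) : ℂ) ^ (-s) - (x : ℂ) ^ (-s)‖ ≤ ‖s‖ * x ^ (-s.re - 1) := by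
  have h := (convex_Icc (0 : ℝ) 1).norm_image_sub_le_of_norm_hasDerivWithin_le
    (f := fun t : ℝ => ((t + x : ℝ) : ℂ) ^ (-s)) (f' := fun t => -s * ((t + x : ℝ) : ℂ) ^ (-s - 1))
    (C := ‖s‖ * x ^ (-s.re - 1)) (x := 0) (y := t)
    (fun t ht => (hasDerivAt_add_cpow hx ht.1 (-s)).hasDerivWithinAt)
    (fun t ht => by
      have h0 : 0 < t + x := by linarith [ht.1]
      rw [norm_mul, norm_neg, Complex.norm_cpow_eq_rpow_re_of_pos h0]
      gcongr
      simp only [Complex.sub_re, Complex.neg_re, Complex.one_re]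
      exact Real.rpow_le_rpow_of_nonpos hx (by linarith [ht.1]) (by linarith))
    (by simp) ⟨ht, ht1⟩
  simp only [zero_add, sub_zero] at h
  refine h.trans ?_
  rw [Real.norm_of_nonneg ht]
  exact mul_le_of_le_one_right (by positivity) ht1

/-- The error of comparing a term of the Hurwitz series with the corresponding integral. -/
noncomputable def hurwitzDefect (s : ℂ) (x : ℝ) : ℂ :=
  (x : ℂ) ^ (-s) - (((x + 1 : ℝ) : ℂ) ^ (1 - s) - (x : ℂ) ^ (1 - s)) / (1 - s)

theorem norm_hurwitzDefect_le {x : ℝ} (hx : 0 < x) {s : ℂ} (hs : 0 < s.re) (hs1 : s ≠ 1) :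
    ‖hurwitzDefect s x‖ ≤ ‖s‖ * x ^ (-s.re - 1) := by
  have hs1' : 1 - s ≠ 0 := sub_ne_zero.2 hs1.symm
  have h := (convex_Icc (0 : ℝ) 1).norm_image_sub_le_of_norm_hasDerivWithin_le
    (f := fun t : ℝ => ((t + x : ℝ) : ℂ) ^ (1 - s) / (1 - s) - (x : ℂ) ^ (-s) * (t : ℂ))
    (f' := fun t => ((t + x : ℝ) : ℂ) ^ (-s) - (x : ℂ) ^ (-s))
    (C := ‖s‖ * x ^ (-s.re - 1)) (x := 0) (y := 1)
    (fun t ht => by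
      have h1 := (hasDerivAt_add_cpow hx ht.1 (1 - s)).div_const (1 - s)
      rw [mul_div_cancel_left₀ _ hs1', show 1 - s - 1 = -s by ring] at h1
      have h2 := (hasDerivAt_id t).ofReal_comp.const_mul ((x : ℂ) ^ (-s))
      simp only [id, Complex.ofReal_one, mul_one] at h2
      exact (h1.sub h2).hasDerivWithinAt)
    (fun t ht => norm_cpow_neg_sub_le hx ht.1 ht.2 hs) (by simp) (by simp)
  simp only [zero_add, sub_zero, norm_one, mul_one, Complex.ofReal_one, Complex.ofReal_zero,
    mul_zero] at h
  rw [← norm_neg, hurwitzDefect]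
  refine le_trans (le_of_eq ?_) h
  congr 1
  rw [add_comm x 1]; ring

theorem sum_hurwitzDefect (s : ℂ) (θ : ℝ) (M : ℕ) :
    ∑ n ∈ Finset.range M, hurwitzDefect s (n + θ) = ∑ n ∈ Finset.range M, ((n + θ : ℝ) : ℂ) ^ (-s) -
      (((M + θ : ℝ) : ℂ) ^ (1 - s) - (θ : ℂ) ^ (1 - s)) / (1 - s) := by
  simp only [hurwitzDefect]
  rw [Finset.sum_sub_distrib, ← Finset.sum_div]
  congr 2
  have := Finset.sum_range_sub (fun n : ℕ => ((n + θ : ℝ) : ℂ) ^ (1 - s)) M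
  simp only [Nat.cast_zero, zero_add] at this
  rw [← this]
  refine Finset.sum_congr rfl fun n _ => ?_
  rw [show (n : ℝ) + θ + 1 = ((n + 1 : ℕ) : ℝ) + θ by push_cast; ring]

theorem tendsto_hurwitz_half {θ : ℝ} (h0 : 0 < θ) (h1 : θ ≤ 1) :
    Tendsto (fun M : ℕ => ((∑ n ∈ Finset.range M, (√(n + θ))⁻¹ - 2 * √(M + θ) : ℝ) : ℂ)) atTop
      (𝓝 (hurwitzZeta (θ : UnitAddCircle) (1 / 2))) := by
  set Ω : Set ℂ := {s | 1 / 4 < s.re} ∩ {s | -(3 / 4) < s.im - s.re} ∩ Metric.ball 0 10 with hΩ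
  have hopen : IsOpen Ω := by
    refine (IsOpen.inter ?_ ?_).inter Metric.isOpen_ball
    · exact isOpen_lt continuous_const Complex.continuous_re
    · exact isOpen_lt continuous_const (Complex.continuous_im.sub Complex.continuous_re)
  have hconv : Convex ℝ Ω := by
    refine (Convex.inter ?_ ?_).inter (convex_ball _ _)
    · exact convex_halfSpace_re_gt _
    · exact convex_halfSpace_gt (f := fun s : ℂ => s.im - s.re)
        ⟨fun x y => by simp; ring, fun c x => by simp; ring⟩ _
  have hne1 : ∀ s ∈ Ω, s ≠ 1 := by
    rintro s ⟨⟨-, hs⟩, -⟩ rfl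
    norm_num at hs
  set u : ℕ → ℝ := fun n => 10 * θ ^ (-11 : ℝ) * ((n + 1 : ℕ) : ℝ) ^ (-(5 / 4) : ℝ) with hu
  have hsum : Summable u := by
    refine Summable.mul_left _ ?_
    exact (summable_nat_add_iff 1).2 (Real.summable_nat_rpow.2 (by norm_num))
  have hbound : ∀ (n : ℕ) (s : ℂ), s ∈ Ω → ‖hurwitzDefect s (n + θ)‖ ≤ u n := by
    intro n s hs
    have hx : 0 < (n : ℝ) + θ := by positivity
    have hre : 1 / 4 < s.re := hs.1.1
    have hnorm : ‖s‖ < 10 := by simpa using hs.2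
    have hre2 : s.re ≤ 10 := (Complex.re_le_norm s).trans hnorm.le
    refine (norm_hurwitzDefect_le hx (by linarith) (hne1 s hs)).trans ?_
    rw [hu]
    simp only
    rw [mul_assoc]
    refine mul_le_mul hnorm.le ?_ (by positivity) (by norm_num)
    have hle : θ * ((n + 1 : ℕ) : ℝ) ≤ n + θ := by
      push_cast
      nlinarith [(Nat.cast_nonneg n : (0 : ℝ) ≤ n)]
    calc ((n : ℝ) + θ) ^ (-s.re - 1) ≤ (θ * ((n + 1 : ℕ) : ℝ)) ^ (-s.re - 1) :=
          Real.rpow_le_rpow_of_nonpos (by positivity) hle (by linarith)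
      _ = θ ^ (-s.re - 1) * ((n + 1 : ℕ) : ℝ) ^ (-s.re - 1) :=
          Real.mul_rpow h0.le (by positivity)
      _ ≤ _ := by
          refine mul_le_mul ?_ ?_ (by positivity) (by positivity)
          · exact Real.rpow_le_rpow_of_exponent_ge h0 h1 (by linarith)
          · exact Real.rpow_le_rpow_of_exponent_le (by simp) (by linarith)
  have hdiffE : DifferentiableOn ℂ (fun s => ∑' n : ℕ, hurwitzDefect s (n + θ)) Ω := by
    refine Complex.differentiableOn_tsum_of_summable_norm hsum (fun n => ?_) hopen hbound
    intro s hs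
    have hx : ((n + θ : ℝ) : ℂ) ≠ 0 := by
      have : 0 < (n : ℝ) + θ := by positivity
      exact_mod_cast this.ne'
    have hx' : ((n + θ + 1 : ℝ) : ℂ) ≠ 0 := by
      have : 0 < (n : ℝ) + θ + 1 := by positivity
      exact_mod_cast this.ne'
    have hs1' : 1 - s ≠ 0 := sub_ne_zero.2 (hne1 s hs).symm
    refine DifferentiableAt.differentiableWithinAt ?_
    unfold hurwitzDefect
    refine DifferentiableAt.sub ?_ (DifferentiableAt.div (DifferentiableAt.sub ?_ ?_) ?_ hs1')
    · exact differentiableAt_id.neg.const_cpow (Or.inl hx)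
    · exact (differentiableAt_id.const_sub 1).const_cpow (Or.inl hx')
    · exact (differentiableAt_id.const_sub 1).const_cpow (Or.inl hx)
    · exact differentiableAt_id.const_sub 1
  have hθ0 : (θ : ℂ) ≠ 0 := by exact_mod_cast h0.ne'
  have hdiffZ : DifferentiableOn ℂ
      (fun s => hurwitzZeta (θ : UnitAddCircle) s + (θ : ℂ) ^ (1 - s) / (1 - s)) Ω := by
    intro s hs
    have hs1' : 1 - s ≠ 0 := sub_ne_zero.2 (hne1 s hs).symm
    refine DifferentiableAt.differentiableWithinAt ?_
    exact (differentiableAt_hurwitzZeta _ (hne1 s hs)).add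
      (((differentiableAt_id.const_sub 1).const_cpow (Or.inl hθ0)).div
        (differentiableAt_id.const_sub 1) hs1')
  have htends : ∀ s ∈ Ω, Tendsto (fun M : ℕ => ∑ n ∈ Finset.range M, hurwitzDefect s (n + θ)) atTop
      (𝓝 (∑' n : ℕ, hurwitzDefect s (n + θ))) := fun s hs =>
    (Summable.of_norm_bounded hsum fun n => hbound n s hs).hasSum.tendsto_sum_nat
  have heq1 : ∀ s ∈ Ω, 1 < s.re → ∑' n : ℕ, hurwitzDefect s (n + θ) =
      hurwitzZeta (θ : UnitAddCircle) s + (θ : ℂ) ^ (1 - s) / (1 - s) := by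
    intro s hs hre
    refine tendsto_nhds_unique (htends s hs) ?_
    have hH := (hasSum_hurwitzZeta_of_one_lt_re (a := θ) ⟨h0.le, h1⟩ hre).tendsto_sum_nat
    have hz : Tendsto (fun M : ℕ => ((M + θ : ℝ) : ℂ) ^ (1 - s)) atTop (𝓝 0) := by
      rw [tendsto_zero_iff_norm_tendsto_zero]
      have h2 : Tendsto (fun M : ℕ => (M + θ : ℝ)) atTop atTop :=
        tendsto_atTop_add_const_right _ _ tendsto_natCast_atTop_atTop
      refine ((tendsto_rpow_neg_atTop (y := s.re - 1) (by linarith)).comp h2).congr fun M => ?_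
      have hx : 0 < (M : ℝ) + θ := by positivity
      rw [Complex.norm_cpow_eq_rpow_re_of_pos hx]
      simp
    have h3 := hH.sub ((hz.sub_const ((θ : ℂ) ^ (1 - s))).div_const (1 - s))
    rw [zero_sub, neg_div, sub_neg_eq_add] at h3
    refine h3.congr fun M => ?_
    rw [sum_hurwitzDefect]
    congr 1
    refine Finset.sum_congr rfl fun n _ => ?_
    rw [Complex.cpow_neg, one_div]; push_cast; rfl
  have hEqOn := (hdiffE.analyticOnNhd hopen).eqOn_of_preconnected_of_eventuallyEq
    (hdiffZ.analyticOnNhd hopen) hconv.isPreconnected (z₀ := 2 + 2 * Complex.I)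
    (by
      refine ⟨⟨?_, ?_⟩, ?_⟩
      · norm_num
      · norm_num
      · rw [mem_ball_zero_iff]
        refine (norm_add_le _ _).trans_lt ?_
        norm_num)
    (by
      have hΩn : Ω ∈ 𝓝 (2 + 2 * Complex.I) := by
        refine hopen.mem_nhds ⟨⟨?_, ?_⟩, ?_⟩
        · norm_num
        · norm_num
        · rw [mem_ball_zero_iff]
          refine (norm_add_le _ _).trans_lt ?_
          norm_num
      have hre : {s : ℂ | 1 < s.re} ∈ 𝓝 (2 + 2 * Complex.I) :=
        (isOpen_lt continuous_const Complex.continuous_re).mem_nhds (by norm_num)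
      filter_upwards [hΩn, hre] with s hs hs' using heq1 s hs hs')
  have hhalf : (1 / 2 : ℂ) ∈ Ω := by
    refine ⟨⟨?_, ?_⟩, ?_⟩
    · norm_num
    · norm_num
    · rw [mem_ball_zero_iff]; norm_num
  have h4 := htends _ hhalf
  rw [show (∑' n : ℕ, hurwitzDefect (1 / 2) (n + θ)) = _ from hEqOn hhalf] at h4
  have h5 := h4.sub_const ((θ : ℂ) ^ (1 - 1 / 2 : ℂ) / (1 - 1 / 2))
  simp only [add_sub_cancel_right] at h5
  refine h5.congr fun M => ?_
  rw [sum_hurwitzDefect]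
  have hsq : ∀ y : ℝ, 0 ≤ y → ((y : ℝ) : ℂ) ^ (1 - 1 / 2 : ℂ) = ((√y : ℝ) : ℂ) := by
    intro y hy
    rw [Real.sqrt_eq_rpow, Complex.ofReal_cpow hy]
    congr 1; push_cast; norm_num
  have hsq' : ∀ y : ℝ, 0 ≤ y → ((y : ℝ) : ℂ) ^ (-(1 / 2) : ℂ) = (((√y)⁻¹ : ℝ) : ℂ) := by
    intro y hy
    rw [Complex.cpow_neg, Real.sqrt_eq_rpow, Complex.ofReal_inv, Complex.ofReal_cpow hy]
    congr 2; push_cast; norm_num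
  rw [hsq _ (by positivity), hsq θ h0.le, Finset.sum_congr rfl fun n _ => hsq' _ (by positivity)]
  push_cast
  ring

/-- The Hurwitz zeta function at `1 / 2`, as a real number. -/
noncomputable def hurwitzHalf (θ : ℝ) : ℝ := (hurwitzZeta (θ : UnitAddCircle) (1 / 2)).re

theorem tendsto_hurwitzHalf {θ : ℝ} (h0 : 0 < θ) (h1 : θ ≤ 1) :
    Tendsto (fun M : ℕ => ∑ n ∈ Finset.range M, (√(n + θ))⁻¹ - 2 * √(M + θ)) atTop
      (𝓝 (hurwitzHalf θ)) := by
  have := (Complex.continuous_re.tendsto _).comp (tendsto_hurwitz_half h0 h1)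
  exact this.congr fun M => Complex.ofReal_re _

theorem hurwitzZeta_half_eq {θ : ℝ} (h0 : 0 < θ) (h1 : θ ≤ 1) :
    hurwitzZeta (θ : UnitAddCircle) (1 / 2) = (hurwitzHalf θ : ℂ) :=
  tendsto_nhds_unique (tendsto_hurwitz_half h0 h1)
    ((Complex.continuous_ofReal.tendsto _).comp (tendsto_hurwitzHalf h0 h1))

theorem hurwitzHalf_anti {θ θ' : ℝ} (h0 : 0 < θ) (h : θ ≤ θ') (h1 : θ' ≤ 1) :
    hurwitzHalf θ' ≤ hurwitzHalf θ := by
  refine le_of_tendsto_of_tendsto' (tendsto_hurwitzHalf (h0.trans_le h) h1)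
    (tendsto_hurwitzHalf h0 (h.trans h1)) fun M => ?_
  refine sub_le_sub (Finset.sum_le_sum fun n _ => ?_) ?_
  · have : 0 < √(n + θ) := Real.sqrt_pos.2 (by positivity)
    gcongr
  · gcongr

theorem two_mul_sqrt_sub_le {x : ℝ} (hx : 0 < x) : 2 * (√(x + 1) - √x) ≤ (√x)⁻¹ := by
  have h0 : 0 < √x := Real.sqrt_pos.2 hx
  rw [← one_div, le_div_iff₀ h0]
  nlinarith [Real.sq_sqrt hx.le, Real.sq_sqrt (by linarith : 0 ≤ x + 1), sq_nonneg (√(x + 1) - √x)]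

theorem inv_sqrt_le_two_mul {x : ℝ} (hx : 0 ≤ x) : (√(x + 1))⁻¹ ≤ 2 * (√(x + 1) - √x) := by
  have h0 : 0 < √(x + 1) := Real.sqrt_pos.2 (by linarith)
  rw [← one_div, div_le_iff₀ h0]
  nlinarith [Real.sq_sqrt hx, Real.sq_sqrt (by linarith : 0 ≤ x + 1), sq_nonneg (√(x + 1) - √x)]

theorem hurwitzHalf_le {θ : ℝ} (h0 : 0 < θ) (h1 : θ ≤ 1) : hurwitzHalf θ ≤ (√θ)⁻¹ := by
  have key : ∀ M : ℕ, ∑ n ∈ Finset.range (M + 1), (√(n + θ))⁻¹ - 2 * √(M + θ) ≤ (√θ)⁻¹ := by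
    intro M
    induction M with
    | zero => simp
    | succ M ih =>
      rw [Finset.sum_range_succ]
      have := inv_sqrt_le_two_mul (x := M + θ) (by positivity)
      rw [show (M : ℝ) + θ + 1 = ((M + 1 : ℕ) : ℝ) + θ by push_cast; ring] at this
      linarith
  refine le_of_tendsto ((tendsto_add_atTop_iff_nat 1).2 (tendsto_hurwitzHalf h0 h1))
    (Eventually.of_forall fun M => le_trans ?_ (key M))
  have : √((M : ℝ) + θ) ≤ √(((M + 1 : ℕ) : ℝ) + θ) := Real.sqrt_le_sqrt (by push_cast; linarith)
  linarith

theorem le_hurwitzHalf {θ : ℝ} (h0 : 0 < θ) (h1 : θ ≤ 1) : (√θ)⁻¹ - 3 ≤ hurwitzHalf θ := by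
  have key : ∀ M : ℕ, (√θ)⁻¹ - 3 ≤
      ∑ n ∈ Finset.range (M + 1), (√(n + θ))⁻¹ - 2 * √((M + 1 : ℕ) + θ) := by
    intro M
    induction M with
    | zero =>
      have : √(1 + θ) ≤ 3 / 2 := Real.sqrt_le_iff.2 ⟨by norm_num, by linarith⟩
      simp
      linarith
    | succ M ih =>
      rw [Finset.sum_range_succ]
      have := two_mul_sqrt_sub_le (x := ((M + 1 : ℕ) : ℝ) + θ) (by positivity)
      rw [show (((M + 1 : ℕ) : ℝ) + θ) + 1 = ((M + 1 + 1 : ℕ) : ℝ) + θ by push_cast; ring] at this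
      linarith
  exact ge_of_tendsto ((tendsto_add_atTop_iff_nat 1).2 (tendsto_hurwitzHalf h0 h1))
    (Eventually.of_forall key)

theorem abs_hurwitzHalf_le {θ : ℝ} (h0 : 0 < θ) (h1 : θ ≤ 1) :
    |hurwitzHalf θ| ≤ 3 * (√θ)⁻¹ := by
  have h2 : 1 ≤ (√θ)⁻¹ := (one_le_inv₀ (Real.sqrt_pos.2 h0)).2 (Real.sqrt_le_one.2 h1)
  rw [abs_le]
  constructor
  · linarith [le_hurwitzHalf h0 h1]
  · linarith [hurwitzHalf_le h0 h1]

end Hurwitz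

section LargeRange

theorem norm_sum_mul_le_of_antitone {A : ℕ → ℂ} {g : ℕ → ℝ} {Z Y : ℕ} {T G : ℝ}
    (hA : ∀ N, Z + N ≤ Y → ‖∑ x ∈ Finset.Ico Z (Z + N), A x‖ ≤ T)
    (hg : ∀ x, Z ≤ x → x + 1 < Y → g (x + 1) ≤ g x) (hG : ∀ x, Z ≤ x → x < Y → |g x| ≤ G)
    (hT : 0 ≤ T) (hG0 : 0 ≤ G) :
    ‖∑ x ∈ Finset.Ico Z Y, (g x : ℂ) * A x‖ ≤ 3 * G * T := by
  have key : ∀ n, Z + n < Y → ‖∑ x ∈ Finset.Ico Z (Z + (n + 1)), (g x : ℂ) * A x -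
      (g (Z + n) : ℂ) * ∑ x ∈ Finset.Ico Z (Z + (n + 1)), A x‖ ≤ T * (g Z - g (Z + n)) := by
    intro n
    induction n with
    | zero => simp
    | succ n ih =>
      intro hn
      have h1 := ih (by omega)
      have h2 := hg (Z + n) (by omega) (by omega)
      have h3 := hA (n + 1) (by omega)
      rw [show Z + (n + 1 + 1) = (Z + (n + 1)) + 1 by ring,
        Finset.sum_Ico_succ_top (by omega), Finset.sum_Ico_succ_top (by omega)]
      set S₁ := ∑ x ∈ Finset.Ico Z (Z + (n + 1)), (g x : ℂ) * A x
      set S₂ := ∑ x ∈ Finset.Ico Z (Z + (n + 1)), A x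
      have h4 : S₁ + (g (Z + (n + 1)) : ℂ) * A (Z + (n + 1)) -
          (g (Z + (n + 1)) : ℂ) * (S₂ + A (Z + (n + 1))) =
          (S₁ - (g (Z + n) : ℂ) * S₂) + ((g (Z + n) - g (Z + (n + 1)) : ℝ) : ℂ) * S₂ := by
        push_cast; ring
      rw [h4]
      refine (norm_add_le _ _).trans ?_
      rw [norm_mul, Complex.norm_real, Real.norm_of_nonneg (by rw [← add_assoc]; linarith)]
      rw [← add_assoc] at *
      nlinarith
  rcases le_or_gt Y Z with h | h
  · rw [Finset.Ico_eq_empty (by omega)]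
    simp only [Finset.sum_empty, norm_zero]
    positivity
  · obtain ⟨n, rfl⟩ : ∃ n, Y = Z + (n + 1) := ⟨Y - Z - 1, by omega⟩
    have h1 := key n (by omega)
    have h2 := hA (n + 1) le_rfl
    have h3 := hG Z le_rfl (by omega)
    have h4 := hG (Z + n) (by omega) (by omega)
    set S₁ := ∑ x ∈ Finset.Ico Z (Z + (n + 1)), (g x : ℂ) * A x
    set S₂ := ∑ x ∈ Finset.Ico Z (Z + (n + 1)), A x
    have h5 : S₁ = (S₁ - (g (Z + n) : ℂ) * S₂) + (g (Z + n) : ℂ) * S₂ := by ring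
    rw [h5]
    refine (norm_add_le _ _).trans ?_
    rw [norm_mul, Complex.norm_real, Real.norm_eq_abs]
    have h6 : |g (Z + n)| * ‖S₂‖ ≤ G * T := by gcongr
    have h7 : g Z - g (Z + n) ≤ 2 * G := by
      linarith [(abs_le.1 h3).2, (abs_le.1 h4).1]
    nlinarith

variable {q : ℕ} [Fact q.Prime]

theorem stdAddChar_ne_one {m : ZMod q} (hm : m ≠ 0) : (ZMod.stdAddChar m : ℂ) ≠ 1 := by
  intro h
  exact hm (ZMod.injective_stdAddChar (h.trans (AddChar.map_zero_eq_one _).symm))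

theorem norm_sum_Ico_stdAddChar_le {m : ZMod q} (hm : m ≠ 0) (Z N : ℕ) :
    ‖∑ y ∈ Finset.Ico Z (Z + N), (ZMod.stdAddChar (m * (y : ZMod q)) : ℂ)‖ ≤
      2 / ‖(ZMod.stdAddChar m : ℂ) - 1‖ := by
  have h1 : ∀ y : ℕ, (ZMod.stdAddChar (m * (y : ZMod q)) : ℂ) = (ZMod.stdAddChar m : ℂ) ^ y := by
    intro y
    rw [mul_comm, ← nsmul_eq_mul, AddChar.map_nsmul_eq_pow]
  simp only [h1]
  rw [geom_sum_Ico (stdAddChar_ne_one hm) (by omega), norm_div]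
  gcongr
  refine (norm_sub_le _ _).trans ?_
  rw [norm_pow, norm_pow, norm_stdAddChar]
  norm_num

theorem inv_sin_pi_mul_le {t : ℝ} (h0 : 0 < t) (h1 : t < 1) :
    (Real.sin (π * t))⁻¹ ≤ (t⁻¹ + (1 - t)⁻¹) / 2 := by
  have key : ∀ t : ℝ, 0 < t → t ≤ 1 / 2 → (Real.sin (π * t))⁻¹ ≤ t⁻¹ / 2 := by
    intro t h0 h1
    have h2 := Real.mul_le_sin (x := π * t) (by positivity) (by nlinarith [Real.pi_pos])
    have h3 : 2 / π * (π * t) = 2 * t := by field_simp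
    rw [h3] at h2
    calc (Real.sin (π * t))⁻¹ ≤ (2 * t)⁻¹ := by gcongr
      _ = _ := by rw [mul_inv]; ring
  have h3 : 0 < (1 - t)⁻¹ := inv_pos.2 (by linarith)
  have h4 : 0 < t⁻¹ := inv_pos.2 h0
  rcases le_total t (1 / 2) with h | h
  · linarith [key t h0 h]
  · have := key (1 - t) (by linarith) (by linarith)
    rw [show π * (1 - t) = π - π * t by ring, Real.sin_pi_sub] at this
    linarith

theorem norm_stdAddChar_natCast_sub_one {j : ℕ} (hj : j ≤ q) :
    ‖(ZMod.stdAddChar (j : ZMod q) : ℂ) - 1‖ = 2 * Real.sin (π * (j / q)) := by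
  have hq : (0 : ℝ) < q := by exact_mod_cast (Fact.out : q.Prime).pos
  have h1 : (ZMod.stdAddChar (j : ZMod q) : ℂ) =
      Complex.exp (Complex.I * ((2 * (π * (j / q)) : ℝ) : ℂ)) := by
    have := ZMod.stdAddChar_coe (N := q) (j : ℤ)
    rw [Int.cast_natCast] at this
    rw [this]
    congr 1
    push_cast
    ring
  rw [h1, Complex.norm_exp_I_mul_ofReal_sub_one, mul_div_cancel_left₀ _ two_ne_zero,
    Real.norm_of_nonneg]
  have h2 : (j : ℝ) / q ≤ 1 := by
    rw [div_le_one hq]; exact_mod_cast hj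
  have h3 := Real.sin_nonneg_of_nonneg_of_le_pi (x := π * (j / q)) (by positivity)
    (by nlinarith [Real.pi_pos])
  linarith

theorem sum_erase_zero_eq_sum_Ico {M : Type*} [AddCommMonoid M] (F : ZMod q → M) :
    ∑ m ∈ Finset.univ.erase (0 : ZMod q), F m = ∑ j ∈ Finset.Ico 1 q, F (j : ZMod q) := by
  symm
  refine Finset.sum_bij (fun j _ => (j : ZMod q)) ?_ ?_ ?_ (fun _ _ => rfl)
  · intro j hj
    rw [Finset.mem_Ico] at hj
    simpa using natCast_zmod_ne_zero (by omega) hj.2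
  · intro x hx y hy h
    exact natCast_injOn_zmod_Ico 0 q le_rfl (by simp at *; omega) (by simp at *; omega) h
  · intro m hm
    refine ⟨m.val, ?_, ZMod.natCast_zmod_val m⟩
    have h1 := ZMod.val_lt m
    have h2 : m.val ≠ 0 := by
      rw [Ne, ZMod.val_eq_zero]; exact (Finset.mem_erase.1 hm).1
    rw [Finset.mem_Ico]; omega

theorem sum_inv_norm_stdAddChar_sub_one_le :
    ∑ m ∈ Finset.univ.erase (0 : ZMod q), (‖(ZMod.stdAddChar m : ℂ) - 1‖)⁻¹ ≤
      q / 2 * (1 + Real.log q) := by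
  have hq1 := (Fact.out : q.Prime).one_lt
  have hq : (0 : ℝ) < q := by exact_mod_cast (Fact.out : q.Prime).pos
  rw [sum_erase_zero_eq_sum_Ico]
  have h1 : ∀ j ∈ Finset.Ico 1 q, (‖(ZMod.stdAddChar (j : ZMod q) : ℂ) - 1‖)⁻¹ ≤
      q / 4 * ((j : ℝ)⁻¹ + ((q - j : ℕ) : ℝ)⁻¹) := by
    intro j hj
    rw [Finset.mem_Ico] at hj
    have hj0 : (0 : ℝ) < j := by exact_mod_cast (by omega : 0 < j)
    have hjq : (j : ℝ) < q := by exact_mod_cast hj.2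
    have hd : (0 : ℝ) < q - j := by linarith
    rw [norm_stdAddChar_natCast_sub_one hj.2.le, mul_inv, Nat.cast_sub hj.2.le]
    have h2 := inv_sin_pi_mul_le (t := j / q) (by positivity) ((div_lt_one hq).2 hjq)
    have h3 : ((j / q : ℝ)⁻¹ + (1 - j / q : ℝ)⁻¹) = q * ((j : ℝ)⁻¹ + ((q : ℝ) - j)⁻¹) := by
      have : (1 - j / q : ℝ) = (q - j) / q := by field_simp
      rw [this, inv_div, inv_div]; ring
    rw [h3] at h2
    linarith
  refine (Finset.sum_le_sum h1).trans ?_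
  rw [← Finset.mul_sum, Finset.sum_add_distrib]
  have h2 : ∑ j ∈ Finset.Ico 1 q, ((q - j : ℕ) : ℝ)⁻¹ = ∑ j ∈ Finset.Ico 1 q, (j : ℝ)⁻¹ := by
    refine Finset.sum_nbij' (fun j => q - j) (fun j => q - j) ?_ ?_ ?_ ?_ ?_
    all_goals intro j hj; rw [Finset.mem_Ico] at hj
    · rw [Finset.mem_Ico]; omega
    · rw [Finset.mem_Ico]; omega
    · omega
    · omega
  have h3 : ∑ j ∈ Finset.Ico 1 q, (j : ℝ)⁻¹ ≤ 1 + Real.log q := by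
    have h4 := harmonic_le_one_add_log q
    rw [harmonic_eq_sum_Icc] at h4
    push_cast at h4
    refine le_trans (Finset.sum_le_sum_of_subset_of_nonneg ?_ fun _ _ _ => by positivity) h4
    exact Finset.Ico_subset_Icc_self
  rw [h2]
  nlinarith

theorem card_mul_sum_curve_eq (a b : ℕ) (c : ZMod q) (g : ℕ → ℝ) (s : Finset ℕ) :
    (q : ℂ) * ((∑ x ∈ s, ∑ y ∈ s,
      if (y : ZMod q) ^ b * (x : ZMod q) ^ a = c then g x * g y else 0 : ℝ) : ℂ) =
    ∑ m : ZMod q, (∑ y ∈ s, (g y : ℂ) * ZMod.stdAddChar (-m * (y : ZMod q))) *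
      ∑ x ∈ s, (g x : ℂ) * curveSum a b c m x := by
  have h1 : ∀ m : ZMod q, (∑ y ∈ s, (g y : ℂ) * ZMod.stdAddChar (-m * (y : ZMod q))) *
      ∑ x ∈ s, (g x : ℂ) * curveSum a b c m x = ∑ x ∈ s, ∑ y ∈ s,
        ∑ u : ZMod q with u ^ b * (x : ZMod q) ^ a = c,
          (g x : ℂ) * g y * ZMod.stdAddChar (m * (u - (y : ZMod q))) := by
    intro m
    rw [Finset.sum_mul_sum, Finset.sum_comm]
    refine Finset.sum_congr rfl fun x _ => Finset.sum_congr rfl fun y _ => ?_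
    rw [curveSum, Finset.mul_sum, Finset.mul_sum]
    refine Finset.sum_congr rfl fun u _ => ?_
    rw [show m * (u - (y : ZMod q)) = -m * y + m * u by ring, AddChar.map_add_eq_mul]
    ring
  simp only [h1]
  rw [Finset.sum_comm (s := Finset.univ)]
  push_cast
  rw [Finset.mul_sum]
  refine Finset.sum_congr rfl fun x _ => ?_
  rw [Finset.mul_sum, Finset.sum_comm (s := Finset.univ)]
  refine Finset.sum_congr rfl fun y _ => ?_
  rw [Finset.sum_comm (s := Finset.univ)]
  have h2 : ∀ u : ZMod q, ∑ m : ZMod q, (g x : ℂ) * g y * ZMod.stdAddChar (m * (u - (y : ZMod q))) =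
      if u = (y : ZMod q) then (q : ℂ) * (g x * g y) else 0 := by
    intro u
    rw [← Finset.mul_sum, AddChar.sum_mulShift _ (ZMod.isPrimitive_stdAddChar q)]
    simp only [sub_eq_zero, ZMod.card]
    split_ifs
    · ring
    · simp
  simp only [h2]
  rw [Finset.sum_ite_eq']
  simp only [Finset.mem_filter, Finset.mem_univ, true_and]
  split_ifs <;> simp

theorem abs_sum_curve_le {a b : ℕ} (hb : 0 < b) {c : ZMod q} (hc : c ≠ 0) {g : ℕ → ℝ} {Z : ℕ}
    {T G : ℝ} (hA : ∀ m : ZMod q, m ≠ 0 → ∀ N, Z + N ≤ q →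
      ‖∑ x ∈ Finset.Ico Z (Z + N), curveSum a b c m x‖ ≤ T)
    (hg : ∀ x, Z ≤ x → x + 1 < q → g (x + 1) ≤ g x) (hG : ∀ x, Z ≤ x → x < q → |g x| ≤ G)
    (hT : 0 ≤ T) (hG0 : 0 ≤ G) :
    |∑ x ∈ Finset.Ico Z q, ∑ y ∈ Finset.Ico Z q,
      if (y : ZMod q) ^ b * (x : ZMod q) ^ a = c then g x * g y else 0| ≤
    |∑ y ∈ Finset.Ico Z q, g y| * (b * ∑ x ∈ Finset.Ico Z q, |g x|) / q +
      9 * G ^ 2 * T * (1 + Real.log q) := by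
  have hq : (0 : ℝ) < q := by exact_mod_cast (Fact.out : q.Prime).pos
  have h := card_mul_sum_curve_eq a b c g (Finset.Ico Z q)
  set S := ∑ x ∈ Finset.Ico Z q, ∑ y ∈ Finset.Ico Z q,
      if (y : ZMod q) ^ b * (x : ZMod q) ^ a = c then g x * g y else 0
  have h1 : (q : ℝ) * |S| ≤ |∑ y ∈ Finset.Ico Z q, g y| * (b * ∑ x ∈ Finset.Ico Z q, |g x|) +
      ∑ m ∈ Finset.univ.erase (0 : ZMod q),
        3 * G * (2 * (‖(ZMod.stdAddChar m : ℂ) - 1‖)⁻¹) * (3 * G * T) := by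
    have h2 : (q : ℝ) * |S| = ‖(q : ℂ) * (S : ℂ)‖ := by
      rw [norm_mul, Complex.norm_real, Complex.norm_natCast, Real.norm_eq_abs]
    rw [h2, h, ← Finset.add_sum_erase Finset.univ _ (Finset.mem_univ (0 : ZMod q))]
    refine (norm_add_le _ _).trans (add_le_add ?_ ((norm_sum_le _ _).trans
      (Finset.sum_le_sum fun m hm => ?_)))
    · rw [norm_mul]
      gcongr
      · simp only [neg_zero, zero_mul, AddChar.map_zero_eq_one, mul_one]
        rw [← Complex.ofReal_sum, Complex.norm_real, Real.norm_eq_abs]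
      · rw [Finset.mul_sum]
        refine (norm_sum_le _ _).trans (Finset.sum_le_sum fun x _ => ?_)
        rw [norm_mul, Complex.norm_real, Real.norm_eq_abs, mul_comm]
        gcongr
        exact norm_curveSum_le a hb hc _ _
    · have hm0 := (Finset.mem_erase.1 hm).1
      rw [norm_mul]
      refine mul_le_mul ?_ (norm_sum_mul_le_of_antitone (hA m hm0) hg hG hT hG0) (norm_nonneg _)
        (by positivity)
      refine norm_sum_mul_le_of_antitone (fun N _ => ?_) hg hG (by positivity) hG0
      refine (norm_sum_Ico_stdAddChar_le (neg_ne_zero.2 hm0) Z N).trans (le_of_eq ?_)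
      rw [div_eq_mul_inv]
      congr 2
      rw [AddChar.map_neg_eq_conj, ← Complex.norm_conj]
      simp
  have h2 : ∑ m ∈ Finset.univ.erase (0 : ZMod q),
      3 * G * (2 * (‖(ZMod.stdAddChar m : ℂ) - 1‖)⁻¹) * (3 * G * T) =
      18 * G ^ 2 * T * ∑ m ∈ Finset.univ.erase (0 : ZMod q),
        (‖(ZMod.stdAddChar m : ℂ) - 1‖)⁻¹ := by
    rw [Finset.mul_sum]
    exact Finset.sum_congr rfl fun m _ => by ring
  rw [h2] at h1
  have h3 : 18 * G ^ 2 * T * ∑ m ∈ Finset.univ.erase (0 : ZMod q),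
        (‖(ZMod.stdAddChar m : ℂ) - 1‖)⁻¹ ≤ 18 * G ^ 2 * T * (q / 2 * (1 + Real.log q)) := by
    gcongr
    exact sum_inv_norm_stdAddChar_sub_one_le
  rw [← sub_le_iff_le_add, le_div_iff₀ hq]
  nlinarith

end LargeRange

section Assembly

theorem sum_Ico_inv_sqrt_le (n : ℕ) : ∑ x ∈ Finset.Ico 1 n, (√(x : ℝ))⁻¹ ≤ 2 * √n := by
  have key : ∀ n : ℕ, ∑ x ∈ Finset.range n, (√((x : ℝ) + 1))⁻¹ ≤ 2 * √n := by
    intro n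
    induction n with
    | zero => simp
    | succ n ih =>
      rw [Finset.sum_range_succ]
      have := inv_sqrt_le_two_mul (x := n) (by positivity)
      push_cast
      linarith
  rw [Finset.sum_Ico_eq_sum_range]
  have h1 : ∀ x : ℕ, (√((1 + x : ℕ) : ℝ))⁻¹ = (√((x : ℝ) + 1))⁻¹ := fun x => by
    push_cast; rw [add_comm]
  simp only [h1]
  refine (key _).trans ?_
  gcongr
  exact Nat.sub_le _ _

theorem mul_sqrt_le_of_bounds {k X Y R A B C : ℝ} (hX : 0 < X) (hY : 0 < Y) (hR : 1 ≤ R)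
    (hA : 0 ≤ A) (hB : 0 ≤ B) (hC : 0 ≤ C) (h1 : k ≤ B * X) (h2 : k ≤ A * Y)
    (h3 : X < Y * R → Y < X * R → k * R ≤ C * (2 * max X Y)) :
    k * √R ≤ (A + B + 2 * C) * √(X * Y) := by
  have hR0 : 0 < √R := Real.sqrt_pos.2 (by linarith)
  have hs : 0 ≤ √(X * Y) := Real.sqrt_nonneg _
  rcases le_or_gt (Y * R) X with h | h
  · have h4 : Y * √R ≤ √(X * Y) := by
      refine Real.le_sqrt_of_sq_le ?_
      rw [mul_pow, Real.sq_sqrt (by linarith)]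
      nlinarith
    calc k * √R ≤ A * Y * √R := by gcongr
      _ = A * (Y * √R) := by ring
      _ ≤ A * √(X * Y) := by gcongr
      _ ≤ _ := by gcongr; linarith
  rcases le_or_gt (X * R) Y with h' | h'
  · have h4 : X * √R ≤ √(X * Y) := by
      refine Real.le_sqrt_of_sq_le ?_
      rw [mul_pow, Real.sq_sqrt (by linarith)]
      nlinarith
    calc k * √R ≤ B * X * √R := by gcongr
      _ = B * (X * √R) := by ring
      _ ≤ B * √(X * Y) := by gcongr
      _ ≤ _ := by gcongr; linarith
  · have h4 : max X Y ≤ √(X * Y) * √R := by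
      rw [← Real.sqrt_mul (by positivity)]
      refine Real.le_sqrt_of_sq_le ?_
      rcases max_choice X Y with hm | hm <;> rw [hm] <;> nlinarith
    have h5 := h3 h h'
    have h6 : k * √R * √R ≤ 2 * C * √(X * Y) * √R := by
      rw [mul_assoc, Real.mul_self_sqrt (by linarith)]
      nlinarith
    refine (le_of_mul_le_mul_right h6 hR0).trans ?_
    gcongr; linarith

variable {q : ℕ} [Fact q.Prime]

/-- The points of the curve `x ^ a * y ^ b = c` with coordinates in `[1, q)`. -/
noncomputable def curvePoints (a b : ℕ) (c : ZMod q) : Finset (ℕ × ℕ) :=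
  (Finset.Ico 1 q ×ˢ Finset.Ico 1 q).filter
    fun p => (p.2 : ZMod q) ^ b * (p.1 : ZMod q) ^ a = c

theorem mem_curvePoints {a b : ℕ} {c : ZMod q} {p : ℕ × ℕ} : p ∈ curvePoints a b c ↔
    ((1 ≤ p.1 ∧ p.1 < q) ∧ (1 ≤ p.2 ∧ p.2 < q)) ∧
      (p.2 : ZMod q) ^ b * (p.1 : ZMod q) ^ a = c := by
  simp [curvePoints, Finset.mem_product, Finset.mem_Ico]

theorem card_filter_curvePoints_le_fst (a : ℕ) {b : ℕ} (hb : 0 < b) {c : ZMod q} (hc : c ≠ 0)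
    {S : Finset (ℕ × ℕ)} (hS : S ⊆ curvePoints a b c) {X : Finset ℕ} (hX : ∀ p ∈ S, p.1 ∈ X) :
    S.card ≤ b * X.card := by
  refine Finset.card_le_mul_card_image_of_maps_to hX b fun x _ => ?_
  refine le_trans ?_ (card_fiber_le a hb hc (x : ZMod q))
  refine Finset.card_le_card_of_injOn (fun p => (p.2 : ZMod q)) ?_ ?_
  · intro p hp
    obtain ⟨hp1, hp2⟩ := Finset.mem_filter.1 (Finset.mem_coe.1 hp)
    have := (mem_curvePoints.1 (hS hp1)).2
    rw [hp2] at this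
    simpa using this
  · intro p hp p' hp' h
    obtain ⟨hp1, hp2⟩ := Finset.mem_filter.1 (Finset.mem_coe.1 hp)
    obtain ⟨hp1', hp2'⟩ := Finset.mem_filter.1 (Finset.mem_coe.1 hp')
    have h1 := (mem_curvePoints.1 (hS hp1)).1.2
    have h2 := (mem_curvePoints.1 (hS hp1')).1.2
    refine Prod.ext (hp2.trans hp2'.symm) ?_
    exact natCast_injOn_zmod_Ico 0 q le_rfl (by simpa using h1.2) (by simpa using h2.2) h

theorem card_filter_curvePoints_le_snd {a : ℕ} (b : ℕ) (ha : 0 < a) {c : ZMod q} (hc : c ≠ 0)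
    {S : Finset (ℕ × ℕ)} (hS : S ⊆ curvePoints a b c) {Y : Finset ℕ} (hY : ∀ p ∈ S, p.2 ∈ Y) :
    S.card ≤ a * Y.card := by
  rw [← Finset.card_map (Equiv.prodComm ℕ ℕ).toEmbedding]
  refine card_filter_curvePoints_le_fst b ha hc (c := c) ?_ ?_
  · intro p hp
    obtain ⟨p', hp', rfl⟩ := Finset.mem_map.1 hp
    have := mem_curvePoints.1 (hS hp')
    refine mem_curvePoints.2 ⟨⟨this.1.2, this.1.1⟩, ?_⟩
    rw [mul_comm]; exact this.2
  · intro p hp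
    obtain ⟨p', hp', rfl⟩ := Finset.mem_map.1 hp
    exact hY p' hp'

/-- Off the largest and smallest points, the points of the curve contribute little. -/
theorem sum_curvePoints_middle_le {a b : ℕ} (ha : 0 < a) (hb : 0 < b) {c : ZMod q} (hc : c ≠ 0)
    {f : ℕ → ℝ} (hf : ∀ x, 1 ≤ x → x < q → |f x| ≤ 3 * (√(x : ℝ))⁻¹) {R Z B : ℕ} {C : ℝ}
    (hR : 1 ≤ R) (hC : 0 ≤ C)
    (hbox : ∀ N, B ≤ N → N ≤ 2 * (Z * R) → ((boxPoints a b c N).card : ℝ) * R ≤ C * N) :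
    ∑ p ∈ (curvePoints a b c).filter (fun p => (p.1 < Z ∨ p.2 < Z) ∧ (B ≤ p.1 ∨ B ≤ p.2)),
      |f p.1 * f p.2| ≤ 36 * (a + b + 2 * C) * (1 + Real.log q) ^ 2 / √R := by
  have hq1 := (Fact.out : q.Prime).one_lt
  set W := (curvePoints a b c).filter (fun p => (p.1 < Z ∨ p.2 < Z) ∧ (B ≤ p.1 ∨ B ≤ p.2))
    with hW
  have hR0 : 0 < √(R : ℝ) := Real.sqrt_pos.2 (by exact_mod_cast hR)
  set L := Nat.log 2 q + 1 with hL
  have hmaps : ∀ p ∈ W, (Nat.log 2 p.1, Nat.log 2 p.2) ∈ Finset.range L ×ˢ Finset.range L := by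
    intro p hp
    have h1 := (mem_curvePoints.1 (Finset.mem_filter.1 hp).1).1
    rw [Finset.mem_product, Finset.mem_range, Finset.mem_range, hL]
    exact ⟨Nat.lt_succ_of_le (Nat.log_mono_right (b := 2) h1.1.2.le),
      Nat.lt_succ_of_le (Nat.log_mono_right (b := 2) h1.2.2.le)⟩
  rw [← Finset.sum_fiberwise_of_maps_to hmaps]
  have hclass : ∀ ij ∈ Finset.range L ×ˢ Finset.range L,
      ∑ p ∈ W with (Nat.log 2 p.1, Nat.log 2 p.2) = ij, |f p.1 * f p.2| ≤
        9 * (a + b + 2 * C) / √R := by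
    rintro ⟨i, j⟩ -
    set S := W.filter (fun p => (Nat.log 2 p.1, Nat.log 2 p.2) = (i, j)) with hS
    have hmem : ∀ p ∈ S, p ∈ curvePoints a b c ∧ ((p.1 < Z ∨ p.2 < Z) ∧ (B ≤ p.1 ∨ B ≤ p.2)) ∧
        (2 ^ i ≤ p.1 ∧ p.1 < 2 ^ (i + 1)) ∧ (2 ^ j ≤ p.2 ∧ p.2 < 2 ^ (j + 1)) := by
      intro p hp
      obtain ⟨h1, h2⟩ := Finset.mem_filter.1 hp
      obtain ⟨h3, h4⟩ := Finset.mem_filter.1 h1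
      obtain ⟨rfl, rfl⟩ := Prod.mk.inj h2
      have h5 := (mem_curvePoints.1 h3).1
      exact ⟨h3, h4, ⟨Nat.pow_log_le_self 2 (by omega), Nat.lt_pow_succ_log_self (by norm_num) _⟩,
        ⟨Nat.pow_log_le_self 2 (by omega), Nat.lt_pow_succ_log_self (by norm_num) _⟩⟩
    have hsub : S ⊆ curvePoints a b c := fun p hp => (hmem p hp).1
    have hcard : (S.card : ℝ) * √R ≤ (a + b + 2 * C) * √((2 : ℝ) ^ i * 2 ^ j) := by
      refine mul_sqrt_le_of_bounds (by positivity) (by positivity) (by exact_mod_cast hR)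
        (by positivity) (by positivity) hC ?_ ?_ ?_
      · have := card_filter_curvePoints_le_fst a hb hc hsub (X := Finset.Ico (2 ^ i) (2 ^ (i + 1)))
          (fun p hp => Finset.mem_Ico.2 (hmem p hp).2.2.1)
        rw [Nat.card_Ico, show 2 ^ (i + 1) - 2 ^ i = 2 ^ i by rw [pow_succ]; omega] at this
        exact_mod_cast this
      · have := card_filter_curvePoints_le_snd b ha hc hsub (Y := Finset.Ico (2 ^ j) (2 ^ (j + 1)))
          (fun p hp => Finset.mem_Ico.2 (hmem p hp).2.2.2)
        rw [Nat.card_Ico, show 2 ^ (j + 1) - 2 ^ j = 2 ^ j by rw [pow_succ]; omega] at this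
        exact_mod_cast this
      · intro h1 h2
        rcases S.eq_empty_or_nonempty with hS0 | ⟨p₀, hp₀⟩
        · rw [hS0]; simp; positivity
        have h1' : 2 ^ i < 2 ^ j * R := by exact_mod_cast h1
        have h2' : 2 ^ j < 2 ^ i * R := by exact_mod_cast h2
        obtain ⟨-, ⟨hZ, hB⟩, hi, hj⟩ := hmem p₀ hp₀
        rw [pow_succ] at hi hj
        have hN := hbox (2 * max (2 ^ i) (2 ^ j))
          (by rcases hB with hB | hB <;> [have := le_max_left (2 ^ i) (2 ^ j);
            have := le_max_right (2 ^ i) (2 ^ j)] <;> omega)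
          (by
            refine Nat.mul_le_mul_left 2 (max_le ?_ ?_)
            · rcases hZ with hZ | hZ
              · nlinarith
              · exact h1'.le.trans (Nat.mul_le_mul_right _ (by omega))
            · rcases hZ with hZ | hZ
              · exact h2'.le.trans (Nat.mul_le_mul_right _ (by omega))
              · nlinarith)
        push_cast at hN
        refine le_trans ?_ hN
        gcongr
        intro p hp
        obtain ⟨hpc, -, hi, hj⟩ := hmem p hp
        have h3 := mem_curvePoints.1 hpc
        rw [pow_succ] at hi hj
        have := le_max_left (2 ^ i) (2 ^ j)
        have := le_max_right (2 ^ i) (2 ^ j)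
        rw [boxPoints, Finset.mem_filter, Finset.mem_product, Finset.mem_Ico, Finset.mem_Ico]
        refine ⟨⟨⟨h3.1.1.1, ?_⟩, ⟨h3.1.2.1, ?_⟩⟩, h3.2⟩ <;> omega
    have hterm : ∀ p ∈ S, |f p.1 * f p.2| ≤ 9 * (√((2 : ℝ) ^ i * 2 ^ j))⁻¹ := by
      intro p hp
      obtain ⟨hpc, -, hi, hj⟩ := hmem p hp
      have h3 := (mem_curvePoints.1 hpc).1
      have h4 : (2 : ℝ) ^ i ≤ p.1 := by exact_mod_cast hi.1
      have h5 : (2 : ℝ) ^ j ≤ p.2 := by exact_mod_cast hj.1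
      rw [abs_mul, Real.sqrt_mul (by positivity), mul_inv]
      have h6 : (√(p.1 : ℝ))⁻¹ ≤ (√((2 : ℝ) ^ i))⁻¹ := by
        have : 0 < √((2 : ℝ) ^ i) := Real.sqrt_pos.2 (by positivity)
        gcongr
      have h7 : (√(p.2 : ℝ))⁻¹ ≤ (√((2 : ℝ) ^ j))⁻¹ := by
        have : 0 < √((2 : ℝ) ^ j) := Real.sqrt_pos.2 (by positivity)
        gcongr
      calc |f p.1| * |f p.2| ≤ (3 * (√((2 : ℝ) ^ i))⁻¹) * (3 * (√((2 : ℝ) ^ j))⁻¹) := by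
            refine mul_le_mul ((hf _ h3.1.1 h3.1.2).trans ?_) ((hf _ h3.2.1 h3.2.2).trans ?_)
              (abs_nonneg _) (by positivity) <;> gcongr
        _ = _ := by ring
    refine (Finset.sum_le_card_nsmul _ _ _ hterm).trans ?_
    have h8 : 0 < √((2 : ℝ) ^ i * 2 ^ j) := Real.sqrt_pos.2 (by positivity)
    rw [nsmul_eq_mul, le_div_iff₀ hR0, ← div_eq_mul_inv, mul_div_assoc', div_mul_eq_mul_div,
      div_le_iff₀ h8]
    nlinarith
  refine (Finset.sum_le_card_nsmul _ _ _ hclass).trans ?_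
  rw [Finset.card_product, Finset.card_range, nsmul_eq_mul]
  have hlog : 0 ≤ Real.log q := Real.log_natCast_nonneg q
  have hLle : (L : ℝ) ≤ 2 * (1 + Real.log q) := by
    have h1 := Real.natLog_le_logb q 2
    rw [Real.logb, Nat.cast_ofNat] at h1
    have h2 : Real.log q / Real.log 2 ≤ 2 * Real.log q := by
      rw [div_le_iff₀ (Real.log_pos (by norm_num))]
      nlinarith [Real.log_two_gt_d9]
    rw [hL]
    push_cast
    linarith
  have hL2 : (L : ℝ) * L ≤ 4 * (1 + Real.log q) ^ 2 := by
    have : (0 : ℝ) ≤ L := by positivity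
    nlinarith
  push_cast
  calc (L : ℝ) * L * (9 * (a + b + 2 * C) / √R) ≤
      4 * (1 + Real.log q) ^ 2 * (9 * (a + b + 2 * C) / √R) := by gcongr
    _ = _ := by ring

end Assembly

section CurveSums

theorem sum_curve_eq_sum_curvePoints {q : ℕ} [Fact q.Prime] (a b : ℕ) (c : ZMod q) (f : ℕ → ℝ) :
    ∑ x ∈ Finset.Ico 1 q, ∑ y ∈ Finset.Ico 1 q,
      (if (y : ZMod q) ^ b * (x : ZMod q) ^ a = c then f x * f y else 0) =
    ∑ p ∈ curvePoints a b c, f p.1 * f p.2 := by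
  rw [curvePoints, Finset.sum_filter, Finset.sum_product]

/-- On the curve `(l₁ x) ^ a * (l₂ y) ^ b = 1`, the only point with small coordinates is the
obvious one. -/
theorem eq_one_of_curve {q a b : ℕ} [Fact q.Prime] (ha : 0 < a) (hb : 0 < b) {R B l₁ l₂ x y : ℕ}
    (hRB : (R * B) ^ (a + b) ≤ q) (h1 : 1 ≤ l₁) (h1R : l₁ ≤ R) (h2R : l₂ ≤ R)
    (hxB : x < B) (hyB : y < B)
    (h : ((l₁ : ZMod q) * x) ^ a * ((l₂ : ZMod q) * y) ^ b = 1) :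
    (l₁ = 1 ∧ x = 1) ∧ (l₂ = 1 ∧ y = 1) := by
  have hq1 := (Fact.out : q.Prime).one_lt
  have h3 : l₁ * x < R * B := Nat.mul_lt_mul_of_le_of_lt h1R hxB (by omega)
  have h4 : l₂ * y < R * B := Nat.mul_lt_mul_of_le_of_lt h2R hyB (by omega)
  have h5 : (l₁ * x) ^ a * (l₂ * y) ^ b < q := by
    refine lt_of_lt_of_le ?_ hRB
    rw [pow_add]
    exact Nat.mul_lt_mul'' (Nat.pow_lt_pow_left h3 ha.ne') (Nat.pow_lt_pow_left h4 hb.ne')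
  have h6 : (((l₁ * x) ^ a * (l₂ * y) ^ b : ℕ) : ZMod q) = ((1 : ℕ) : ZMod q) := by
    push_cast; exact h
  have h7 := Nat.ModEq.eq_of_lt_of_lt ((ZMod.natCast_eq_natCast_iff _ _ q).1 h6) h5 hq1
  have h8 := mul_eq_one.1 h7
  rw [Nat.pow_eq_one, Nat.pow_eq_one, mul_eq_one, mul_eq_one] at h8
  simpa [ha.ne', hb.ne'] using h8

theorem abs_sum_curve_large_le {q : ℕ} [Fact q.Prime] {a b : ℕ} (hb : 0 < b) {c : ZMod q}
    (hc : c ≠ 0) {f : ℕ → ℝ} (hanti : ∀ x, 1 ≤ x → x + 1 < q → f (x + 1) ≤ f x)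
    (hf : ∀ x, 1 ≤ x → x < q → |f x| ≤ 3 * (√(x : ℝ))⁻¹) {C₀ C₁ D P : ℝ} (hC₀ : 0 ≤ C₀)
    (hC₁ : 0 ≤ C₁) (hD : 0 ≤ D) (hP : 0 < P) (hsum : |∑ x ∈ Finset.Ico 1 q, f x| ≤ C₀) {R Z : ℕ}
    (hR : 1 ≤ R) (hZ : 1 ≤ Z) (hZR : Z * R ≤ q) (hqP : (q : ℝ) * R ≤ D * (Z * P))
    (hA : ∀ m : ZMod q, m ≠ 0 → ∀ N, Z + N ≤ q →
      ‖∑ x ∈ Finset.Ico Z (Z + N), curveSum a b c m x‖ ≤ C₁ * q / P) :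
    |∑ x ∈ Finset.Ico Z q, ∑ y ∈ Finset.Ico Z q,
      (if (y : ZMod q) ^ b * (x : ZMod q) ^ a = c then f x * f y else 0)| ≤
      (6 * b * (C₀ + 6) + 81 * C₁ * D) * (1 + Real.log q) ^ 2 / √R := by
  have hq : (0 : ℝ) < q := by exact_mod_cast (Fact.out : q.Prime).pos
  have hR0 : (0 : ℝ) < R := by exact_mod_cast (by omega : 0 < R)
  have hlog : 1 ≤ 1 + Real.log q := by linarith [Real.log_natCast_nonneg q]
  have hlog2 : 1 + Real.log q ≤ (1 + Real.log q) ^ 2 := by nlinarith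
  have hsR : 0 < √(R : ℝ) := Real.sqrt_pos.2 hR0
  have hbig := abs_sum_curve_le (a := a) hb hc (g := f) (Z := Z) (T := C₁ * q / P)
    (G := 3 * (√(Z : ℝ))⁻¹) hA (fun x hx => hanti x (by omega))
    (fun x hx hxq => (hf x (by omega) hxq).trans (by
      have : 0 < √(Z : ℝ) := Real.sqrt_pos.2 (by exact_mod_cast (by omega : 0 < Z))
      gcongr))
    (by positivity) (by positivity)
  refine hbig.trans ?_
  have hZ0 : (0 : ℝ) < Z := by exact_mod_cast (by omega : 0 < Z)
  have hZs : 1 ≤ √(Z : ℝ) := by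
    rw [Real.one_le_sqrt]; exact_mod_cast (by omega : 1 ≤ Z)
  have hZR' : √(Z : ℝ) * √R ≤ √q := by
    rw [← Real.sqrt_mul (by positivity)]
    exact Real.sqrt_le_sqrt (by exact_mod_cast hZR)
  have hZq : Z ≤ q := by nlinarith
  have hsumZ : |∑ y ∈ Finset.Ico Z q, f y| ≤ (C₀ + 6) * √Z := by
    have h1 : ∑ y ∈ Finset.Ico Z q, f y =
        ∑ y ∈ Finset.Ico 1 q, f y - ∑ y ∈ Finset.Ico 1 Z, f y := by
      rw [← Finset.sum_Ico_consecutive f (by omega : 1 ≤ Z) hZq]; ring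
    have h2 : |∑ y ∈ Finset.Ico 1 Z, f y| ≤ 6 * √Z := by
      refine (Finset.abs_sum_le_sum_abs _ _).trans ?_
      calc ∑ y ∈ Finset.Ico 1 Z, |f y| ≤ ∑ y ∈ Finset.Ico 1 Z, 3 * (√(y : ℝ))⁻¹ := by
            refine Finset.sum_le_sum fun y hy => ?_
            rw [Finset.mem_Ico] at hy
            exact hf y hy.1 (by omega)
        _ = 3 * ∑ y ∈ Finset.Ico 1 Z, (√(y : ℝ))⁻¹ := by rw [Finset.mul_sum]
        _ ≤ 3 * (2 * √Z) := by gcongr; exact sum_Ico_inv_sqrt_le Z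
        _ = _ := by ring
    rw [h1]
    refine (abs_sub _ _).trans ?_
    nlinarith
  have hsumabs : ∑ x ∈ Finset.Ico Z q, |f x| ≤ 6 * √q := by
    calc ∑ x ∈ Finset.Ico Z q, |f x| ≤ ∑ x ∈ Finset.Ico 1 q, |f x| :=
          Finset.sum_le_sum_of_subset_of_nonneg
            (Finset.Ico_subset_Ico_left (by omega)) fun _ _ _ => abs_nonneg _
      _ ≤ ∑ y ∈ Finset.Ico 1 q, 3 * (√(y : ℝ))⁻¹ := by
            refine Finset.sum_le_sum fun y hy => ?_
            rw [Finset.mem_Ico] at hy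
            exact hf y hy.1 hy.2
      _ = 3 * ∑ y ∈ Finset.Ico 1 q, (√(y : ℝ))⁻¹ := by rw [Finset.mul_sum]
      _ ≤ 3 * (2 * √q) := by gcongr; exact sum_Ico_inv_sqrt_le q
      _ = _ := by ring
  have hsq : 0 < √(q : ℝ) := Real.sqrt_pos.2 hq
  have hterm1 : |∑ y ∈ Finset.Ico Z q, f y| * (b * ∑ x ∈ Finset.Ico Z q, |f x|) / q ≤
      6 * b * (C₀ + 6) * (1 + Real.log q) ^ 2 / √R := by
    rw [div_le_div_iff₀ hq hsR]
    calc |∑ y ∈ Finset.Ico Z q, f y| * (b * ∑ x ∈ Finset.Ico Z q, |f x|) * √R ≤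
        (C₀ + 6) * √Z * (b * (6 * √q)) * √R := by gcongr
      _ = 6 * b * (C₀ + 6) * (√Z * √R) * √q := by ring
      _ ≤ 6 * b * (C₀ + 6) * √q * √q := by gcongr
      _ = 6 * b * (C₀ + 6) * 1 * q := by rw [mul_assoc, Real.mul_self_sqrt hq.le]; ring
      _ ≤ _ := by gcongr; linarith
  have hterm2 : 9 * (3 * (√(Z : ℝ))⁻¹) ^ 2 * (C₁ * q / P) * (1 + Real.log q) ≤
      81 * C₁ * D * (1 + Real.log q) ^ 2 / √R := by
    have h1 : (q : ℝ) * √R ≤ D * (Z * P) := by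
      have h2 : √(R : ℝ) ≤ R := by
        rw [Real.sqrt_le_left hR0.le]
        have : (1 : ℝ) ≤ R := by exact_mod_cast hR
        nlinarith
      refine le_trans ?_ hqP
      gcongr
    rw [mul_pow, inv_pow, Real.sq_sqrt hZ0.le, le_div_iff₀ hsR]
    calc 9 * (3 ^ 2 * (Z : ℝ)⁻¹) * (C₁ * q / P) * (1 + Real.log q) * √R =
        81 * C₁ * (q * √R) * ((Z : ℝ) * P)⁻¹ * (1 + Real.log q) := by
          rw [mul_inv]; ring
      _ ≤ 81 * C₁ * (D * (Z * P)) * ((Z : ℝ) * P)⁻¹ * (1 + Real.log q) := by gcongr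
      _ = 81 * C₁ * D * (1 + Real.log q) := by field_simp
      _ ≤ _ := by gcongr
  refine (add_le_add hterm1 hterm2).trans (le_of_eq ?_)
  ring

set_option maxHeartbeats 800000 in
theorem exists_abs_sum_curve_sub_le {a b : ℕ} (ha : 0 < a) (hb : 0 < b) {C₀ : ℝ} (hC₀ : 0 ≤ C₀) :
    ∃ K : ℕ, 0 < K ∧ ∃ C : ℝ, 0 < C ∧ ∀ (q : ℕ) [Fact q.Prime] (R : ℕ) (f : ℕ → ℝ) (l₁ l₂ : ℕ),
      32 ≤ R → R ^ K ≤ q → q ≤ (2 * R) ^ K →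
      (∀ x, 1 ≤ x → x + 1 < q → f (x + 1) ≤ f x) →
      (∀ x, 1 ≤ x → x < q → |f x| ≤ 3 * (√(x : ℝ))⁻¹) →
      |f 1 - 1| ≤ 3 * (√(q : ℝ))⁻¹ → |∑ x ∈ Finset.Ico 1 q, f x| ≤ C₀ →
      1 ≤ l₁ → 1 ≤ l₂ → l₁ ≤ R → l₂ ≤ R →
      |∑ x ∈ Finset.Ico 1 q, ∑ y ∈ Finset.Ico 1 q,
        (if ((l₁ : ZMod q) * x) ^ a * ((l₂ : ZMod q) * y) ^ b = 1 then f x * f y else 0) -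
        (if l₁ = 1 ∧ l₂ = 1 then 1 else 0)| ≤ C * (1 + Real.log q) ^ 2 / √R := by
  set n := a + b with hn
  have hn2 : 2 ≤ n := by omega
  obtain ⟨C₁, hC₁, hlarge⟩ := exists_norm_sum_curveSum_le ha hb (2 * n * n) (2 ^ (100 * n * n))
    (by positivity)
  obtain ⟨C₂, hC₂, hbox⟩ := exists_card_boxPoints_le ha hb (l := 2 * n) (by omega)
    (2 ^ (100 * n * n))
  obtain ⟨D, hD⟩ : ∃ D : ℝ, D = 2 ^ (100 * n * n) := ⟨_, rfl⟩
  have hD0 : 0 ≤ D := by rw [hD]; positivity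
  refine ⟨100 * n * n, by positivity, 36 * (a + b + 2 * C₂) + 6 * b * (C₀ + 6) +
    81 * C₁ * D + 12, by positivity, ?_⟩
  intro q _ R f l₁ l₂ hR hRq hqR hanti hf hf1 hsum hl₁ hl₂ hl₁R hl₂R
  have hqR' : q ≤ 2 ^ (100 * n * n) * R ^ (100 * n * n) := by rwa [← mul_pow]
  obtain ⟨z, hz⟩ : ∃ z, z + (8 * n + 2) = 100 * n * n :=
    ⟨100 * n * n - (8 * n + 2), Nat.sub_add_cancel (by nlinarith)⟩
  have hz1 : 1 ≤ z := by nlinarith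
  set Z := R ^ z with hZ
  set B := R ^ (58 * n + 1) with hB
  have hq1 := (Fact.out : q.Prime).one_lt
  have hq : (0 : ℝ) < q := by exact_mod_cast (Fact.out : q.Prime).pos
  have hR0 : (0 : ℝ) < R := by exact_mod_cast (by omega : 0 < R)
  have hZ2 : 2 ≤ Z := (by omega : 2 ≤ R).trans (Nat.le_self_pow (by omega) R)
  have hB2 : 2 ≤ B := (by omega : 2 ≤ R).trans (Nat.le_self_pow (by omega) R)
  have hZR : Z * R ≤ q := by
    refine le_trans ?_ hRq
    rw [hZ, ← pow_succ]
    exact Nat.pow_le_pow_right (by omega) (by omega)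
  have hRleq : R ≤ q := (Nat.le_self_pow (by positivity) R).trans hRq
  have hRB : (R * B) ^ (a + b) ≤ q := by
    refine le_trans ?_ hRq
    rw [hB, ← pow_succ', ← pow_mul]
    exact Nat.pow_le_pow_right (by omega) (by rw [← hn]; nlinarith)
  have hl₁0 : (l₁ : ZMod q) ≠ 0 := by
    refine natCast_zmod_ne_zero hl₁ (lt_of_le_of_lt hl₁R ?_)
    nlinarith
  have hl₂0 : (l₂ : ZMod q) ≠ 0 := by
    refine natCast_zmod_ne_zero hl₂ (lt_of_le_of_lt hl₂R ?_)
    nlinarith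
  set c : ZMod q := ((l₁ : ZMod q) ^ a * (l₂ : ZMod q) ^ b)⁻¹ with hc
  have hc0 : c ≠ 0 := inv_ne_zero (mul_ne_zero (pow_ne_zero _ hl₁0) (pow_ne_zero _ hl₂0))
  have hiff : ∀ x y : ZMod q, ((l₁ : ZMod q) * x) ^ a * ((l₂ : ZMod q) * y) ^ b = 1 ↔
      y ^ b * x ^ a = c := by
    intro x y
    rw [hc, ← mul_eq_one_iff_eq_inv₀ (mul_ne_zero (pow_ne_zero _ hl₁0) (pow_ne_zero _ hl₂0))]
    rw [mul_pow, mul_pow]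
    constructor <;> intro h <;> rw [← h] <;> ring
  have hlog : 1 ≤ 1 + Real.log q := by linarith [Real.log_natCast_nonneg q]
  have hlog2 : 1 + Real.log q ≤ (1 + Real.log q) ^ 2 := by nlinarith
  have hsR : 0 < √(R : ℝ) := Real.sqrt_pos.2 hR0
  -- the points of intermediate size
  have hmid := sum_curvePoints_middle_le ha hb hc0 hf (R := R) (Z := Z) (B := B) (C := C₂)
    (by omega) (by positivity) (fun N hBN hNZ => by
      have := hbox q c R (R ^ (50 * n)) N hc0 (by omega) (by positivity)
        (le_trans (Nat.pow_le_pow_right (by omega) (by nlinarith)) hRq)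
        (by rw [← pow_mul]; convert hqR' using 3; ring)
        (by
          refine le_trans (le_of_eq ?_) hBN
          rw [hB, ← pow_add, ← pow_succ]
          congr 1; ring)
        (by
          refine le_trans ?_ hRq
          calc 16 * (N * R ^ (4 * (2 * n))) ≤ 16 * (2 * (Z * R) * R ^ (4 * (2 * n))) := by gcongr
            _ = 32 * (Z * R ^ (8 * n + 1)) := by ring
            _ ≤ R * (Z * R ^ (8 * n + 1)) := by gcongr
            _ = R ^ (100 * n * n) := by rw [hZ, ← hz]; ring)
      exact_mod_cast this)
  -- the large points
  have hbig := abs_sum_curve_large_le hb hc0 hanti hf (D := D)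
    (P := R ^ (4 * (2 * n * n))) hC₀ hC₁.le hD0 (by positivity) hsum (R := R) (Z := Z)
    (by omega) (by omega) hZR (by
      have h3 : R ^ (100 * n * n) * R ≤ Z * R ^ (4 * (2 * n * n)) := by
        rw [hZ, ← pow_add, ← pow_succ]
        exact Nat.pow_le_pow_right (by omega) (by nlinarith)
      calc (q : ℝ) * R ≤ ((2 ^ (100 * n * n) * R ^ (100 * n * n) : ℕ) : ℝ) * R := by gcongr
        _ = 2 ^ (100 * n * n) * ((R ^ (100 * n * n) * R : ℕ) : ℝ) := by push_cast; ring
        _ ≤ 2 ^ (100 * n * n) * ((Z * R ^ (4 * (2 * n * n)) : ℕ) : ℝ) := by gcongr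
        _ = _ := by rw [hD]; push_cast; ring)
    (fun m hm N hN => by
      rw [le_div_iff₀ (by positivity)]
      refine hlarge q c m R Z N hc0 hm (by omega) ?_ ?_ (by omega)
      · convert hRq using 2; ring
      · convert hqR' using 3; ring)
  -- the smallest point
  have hsmall : ∑ p ∈ ((curvePoints a b c).filter fun p => p.1 < Z ∨ p.2 < Z).filter
      (fun p => ¬(B ≤ p.1 ∨ B ≤ p.2)), f p.1 * f p.2 =
      (if l₁ = 1 ∧ l₂ = 1 then 1 else 0) * (f 1 * f 1) := by
    have honly : ∀ p ∈ ((curvePoints a b c).filter fun p => p.1 < Z ∨ p.2 < Z).filter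
        (fun p => ¬(B ≤ p.1 ∨ B ≤ p.2)), (l₁ = 1 ∧ p.1 = 1) ∧ (l₂ = 1 ∧ p.2 = 1) := by
      intro p hp
      obtain ⟨hp1, hp2⟩ := Finset.mem_filter.1 hp
      have hp3 := mem_curvePoints.1 (Finset.mem_filter.1 hp1).1
      exact eq_one_of_curve ha hb hRB hl₁ hl₁R hl₂R (by omega) (by omega)
        ((hiff _ _).2 hp3.2)
    split_ifs with h
    · rw [one_mul]
      refine Finset.sum_eq_single_of_mem (1, 1) ?_ fun p hp hne => ?_
      · rw [Finset.mem_filter, Finset.mem_filter, mem_curvePoints]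
        refine ⟨⟨⟨⟨⟨le_rfl, hq1⟩, ⟨le_rfl, hq1⟩⟩, (hiff _ _).1 ?_⟩, ?_⟩, ?_⟩
        · simp [h.1, h.2]
        · simp only; omega
        · simp only; omega
      · exact absurd (Prod.ext (honly p hp).1.2 (honly p hp).2.2) hne
    · rw [zero_mul]
      refine Finset.sum_eq_zero fun p hp => absurd ⟨(honly p hp).1.1, (honly p hp).2.1⟩ h
  have hlargeset : ∑ p ∈ (curvePoints a b c).filter (fun p => ¬(p.1 < Z ∨ p.2 < Z)),
      f p.1 * f p.2 = ∑ x ∈ Finset.Ico Z q, ∑ y ∈ Finset.Ico Z q,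
      (if (y : ZMod q) ^ b * (x : ZMod q) ^ a = c then f x * f y else 0) := by
    rw [← Finset.sum_product', ← Finset.sum_filter]
    refine Finset.sum_congr ?_ fun _ _ => rfl
    ext p
    simp only [Finset.mem_filter, mem_curvePoints, Finset.mem_product, Finset.mem_Ico]
    constructor
    · rintro ⟨⟨h1, h2⟩, h3⟩; exact ⟨by omega, h2⟩
    · rintro ⟨h1, h2⟩; exact ⟨⟨by omega, h2⟩, by omega⟩
  simp only [hiff]
  rw [sum_curve_eq_sum_curvePoints, ← Finset.sum_filter_add_sum_filter_not (curvePoints a b c)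
    (fun p => p.1 < Z ∨ p.2 < Z), hlargeset, ← Finset.sum_filter_add_sum_filter_not
    ((curvePoints a b c).filter _) (fun p => B ≤ p.1 ∨ B ≤ p.2), hsmall, Finset.filter_filter]
  have hmid' := (Finset.abs_sum_le_sum_abs (fun p : ℕ × ℕ => f p.1 * f p.2) _).trans hmid
  set S₁ := ∑ p ∈ (curvePoints a b c).filter
    (fun p => (p.1 < Z ∨ p.2 < Z) ∧ (B ≤ p.1 ∨ B ≤ p.2)), f p.1 * f p.2
  set S₂ := ∑ x ∈ Finset.Ico Z q, ∑ y ∈ Finset.Ico Z q,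
      (if (y : ZMod q) ^ b * (x : ZMod q) ^ a = c then f x * f y else 0)
  have hRsq : (√(q : ℝ))⁻¹ ≤ (√(R : ℝ))⁻¹ := by gcongr
  have hRinv : (√(R : ℝ))⁻¹ ≤ 1 := by
    rw [inv_le_one₀ hsR, Real.one_le_sqrt]; exact_mod_cast (by omega : 1 ≤ R)
  have hmain : |(if l₁ = 1 ∧ l₂ = 1 then 1 else 0) * (f 1 * f 1) -
      (if l₁ = 1 ∧ l₂ = 1 then (1 : ℝ) else 0)| ≤ 12 * (1 + Real.log q) ^ 2 / √R := by
    have h1 : 12 * (√(R : ℝ))⁻¹ ≤ 12 * (1 + Real.log q) ^ 2 / √R := by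
      rw [div_eq_mul_inv]
      gcongr
      nlinarith
    refine le_trans ?_ h1
    split_ifs
    · have h2 : |f 1| ≤ 3 := by simpa using hf 1 le_rfl hq1
      have h3 : |f 1 + 1| ≤ 4 := (abs_add_le _ _).trans (by rw [abs_one]; linarith)
      rw [show 1 * (f 1 * f 1) - 1 = (f 1 - 1) * (f 1 + 1) by ring, abs_mul]
      calc |f 1 - 1| * |f 1 + 1| ≤ 3 * (√(q : ℝ))⁻¹ * 4 := by gcongr
        _ ≤ _ := by linarith
    · simp
  calc |S₁ + (if l₁ = 1 ∧ l₂ = 1 then 1 else 0) * (f 1 * f 1) + S₂ -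
        (if l₁ = 1 ∧ l₂ = 1 then (1 : ℝ) else 0)| =
      |S₁ + S₂ + ((if l₁ = 1 ∧ l₂ = 1 then 1 else 0) * (f 1 * f 1) -
        (if l₁ = 1 ∧ l₂ = 1 then (1 : ℝ) else 0))| := by congr 1; ring
    _ ≤ |S₁| + |S₂| + |(if l₁ = 1 ∧ l₂ = 1 then 1 else 0) * (f 1 * f 1) -
        (if l₁ = 1 ∧ l₂ = 1 then (1 : ℝ) else 0)| := abs_add_three _ _ _
    _ ≤ _ := (add_le_add (add_le_add hmid' hbig) hmain).trans (le_of_eq (by ring))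

end CurveSums

section Reduction

/-- The coefficient of `χ x` in the expression of `L(χ, 1 / 2)` by Hurwitz zeta values. -/
noncomputable def centralWeight (q x : ℕ) : ℝ := (√(q : ℝ))⁻¹ * hurwitzHalf (x / q)

variable {q : ℕ} [Fact q.Prime]

theorem LFunction_half_eq (χ : DirichletCharacter ℂ q) :
    DirichletCharacter.LFunction χ (1 / 2) =
      ∑ x ∈ Finset.Ico 1 q, χ (x : ZMod q) * (centralWeight q x : ℂ) := by
  have hq : (0 : ℝ) < q := by exact_mod_cast (Fact.out : q.Prime).pos
  rw [DirichletCharacter.LFunction, ZMod.LFunction,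
    ← Finset.add_sum_erase Finset.univ _ (Finset.mem_univ (0 : ZMod q)), sum_erase_zero_eq_sum_Ico,
    MulChar.map_zero, zero_mul, zero_add, Finset.mul_sum]
  refine Finset.sum_congr rfl fun x hx => ?_
  rw [Finset.mem_Ico] at hx
  have hx0 : (0 : ℝ) < x := by exact_mod_cast hx.1
  have hxq : (x : ℝ) ≤ q := by exact_mod_cast hx.2.le
  rw [ZMod.toAddCircle_natCast, hurwitzZeta_half_eq (by positivity) ((div_le_one hq).2 hxq),
    centralWeight]
  have h1 : (q : ℂ) ^ (-(1 / 2) : ℂ) = (((√(q : ℝ))⁻¹ : ℝ) : ℂ) := by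
    rw [Complex.cpow_neg, Real.sqrt_eq_rpow, Complex.ofReal_inv, Complex.ofReal_cpow hq.le]
    push_cast; rfl
  rw [h1]
  push_cast
  ring

theorem centralWeight_succ_le {x : ℕ} (hx : 1 ≤ x) (hxq : x + 1 < q) :
    centralWeight q (x + 1) ≤ centralWeight q x := by
  have hq : (0 : ℝ) < q := by exact_mod_cast (Fact.out : q.Prime).pos
  have hx0 : (0 : ℝ) < x := by exact_mod_cast hx
  have hxq' : ((x + 1 : ℕ) : ℝ) ≤ q := by exact_mod_cast hxq.le
  refine mul_le_mul_of_nonneg_left ?_ (by positivity)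
  refine hurwitzHalf_anti (by positivity) ?_ ((div_le_one hq).2 hxq')
  gcongr
  omega

theorem abs_centralWeight_le {x : ℕ} (hx : 1 ≤ x) (hxq : x < q) :
    |centralWeight q x| ≤ 3 * (√(x : ℝ))⁻¹ := by
  have hq : (0 : ℝ) < q := by exact_mod_cast (Fact.out : q.Prime).pos
  have hx0 : (0 : ℝ) < x := by exact_mod_cast hx
  have hxq' : (x : ℝ) ≤ q := by exact_mod_cast hxq.le
  have hs : 0 < √(q : ℝ) := Real.sqrt_pos.2 hq
  have h := abs_hurwitzHalf_le (θ := x / q) (by positivity) ((div_le_one hq).2 hxq')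
  rw [centralWeight, abs_mul, abs_of_pos (inv_pos.2 hs)]
  rw [Real.sqrt_div hx0.le, inv_div] at h
  calc (√(q : ℝ))⁻¹ * |hurwitzHalf (x / q)| ≤ (√(q : ℝ))⁻¹ * (3 * (√q / √x)) := by gcongr
    _ = _ := by field_simp

theorem abs_centralWeight_one_sub_one_le : |centralWeight q 1 - 1| ≤ 3 * (√(q : ℝ))⁻¹ := by
  have hq1 : (1 : ℝ) ≤ q := by exact_mod_cast (Fact.out : q.Prime).one_lt.le
  have hq : (0 : ℝ) < q := by linarith
  have hs : 0 < √(q : ℝ) := Real.sqrt_pos.2 hq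
  have h1 := hurwitzHalf_le (θ := (1 : ℕ) / q) (by positivity) (by
    rw [div_le_one hq]; simpa using hq1)
  have h2 := le_hurwitzHalf (θ := (1 : ℕ) / q) (by positivity) (by
    rw [div_le_one hq]; simpa using hq1)
  have h3 : (√(((1 : ℕ) : ℝ) / q))⁻¹ = √q := by
    rw [Nat.cast_one, one_div, Real.sqrt_inv, inv_inv]
  rw [h3] at h1 h2
  have h4 : centralWeight q 1 - 1 = (√(q : ℝ))⁻¹ * (hurwitzHalf ((1 : ℕ) / q) - √q) := by
    rw [centralWeight, mul_sub, inv_mul_cancel₀ hs.ne']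
  rw [h4, abs_mul, abs_of_pos (inv_pos.2 hs), mul_comm]
  gcongr
  rw [abs_le]
  constructor <;> linarith

theorem abs_sum_centralWeight_le :
    |∑ x ∈ Finset.Ico 1 q, centralWeight q x| ≤ 2 * ‖riemannZeta (1 / 2)‖ := by
  have hqp := (Fact.out : q.Prime)
  have h1 := LFunction_half_eq (1 : DirichletCharacter ℂ q)
  have h2 : ∑ x ∈ Finset.Ico 1 q, (1 : DirichletCharacter ℂ q) (x : ZMod q) *
      (centralWeight q x : ℂ) = ((∑ x ∈ Finset.Ico 1 q, centralWeight q x : ℝ) : ℂ) := by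
    push_cast
    refine Finset.sum_congr rfl fun x hx => ?_
    rw [Finset.mem_Ico] at hx
    rw [MulChar.one_apply (natCast_zmod_ne_zero hx.1 hx.2).isUnit, one_mul]
  rw [h2] at h1
  rw [← Real.norm_eq_abs, ← Complex.norm_real, ← h1]
  have h3 := DirichletCharacter.LFunctionTrivChar_eq_mul_riemannZeta (N := q) (s := 1 / 2)
    (by norm_num)
  rw [DirichletCharacter.LFunctionTrivChar] at h3
  rw [h3, hqp.primeFactors, Finset.prod_singleton, norm_mul]
  gcongr
  refine (norm_sub_le _ _).trans ?_
  have hq1 : (1 : ℝ) ≤ q := by exact_mod_cast hqp.one_lt.le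
  have h4 : ‖(q : ℂ) ^ (-(1 / 2) : ℂ)‖ ≤ 1 := by
    rw [Complex.norm_natCast_cpow_of_pos hqp.pos]
    refine Real.rpow_le_one_of_one_le_of_nonpos hq1 ?_
    norm_num
  rw [norm_one]
  linarith

/-- The second moment over all characters, expressed by orthogonality. -/
theorem sum_LFunction_mul_LFunction_eq {a b : ℕ} (ha : 0 < a) (hb : 0 < b) (l₁ l₂ : ZMod q) :
    ∑ χ : DirichletCharacter ℂ q, χ l₁ ^ a * χ l₂ ^ b *
      DirichletCharacter.LFunction (χ ^ a) (1 / 2) * DirichletCharacter.LFunction (χ ^ b) (1 / 2) =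
    ((q : ℂ) - 1) * ((∑ x ∈ Finset.Ico 1 q, ∑ y ∈ Finset.Ico 1 q,
      (if (l₁ * x) ^ a * (l₂ * y) ^ b = 1 then centralWeight q x * centralWeight q y else 0) : ℝ) :
        ℂ) := by
  have hqp := (Fact.out : q.Prime)
  have h1 : ∀ χ : DirichletCharacter ℂ q, χ l₁ ^ a * χ l₂ ^ b *
      DirichletCharacter.LFunction (χ ^ a) (1 / 2) * DirichletCharacter.LFunction (χ ^ b) (1 / 2) =
      ∑ x ∈ Finset.Ico 1 q, ∑ y ∈ Finset.Ico 1 q, χ ((l₁ * x) ^ a * (l₂ * y) ^ b) *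
        ((centralWeight q x : ℂ) * (centralWeight q y : ℂ)) := by
    intro χ
    rw [LFunction_half_eq, LFunction_half_eq, mul_assoc, Finset.sum_mul_sum, Finset.mul_sum]
    refine Finset.sum_congr rfl fun x _ => ?_
    rw [Finset.mul_sum]
    refine Finset.sum_congr rfl fun y _ => ?_
    rw [MulChar.pow_apply' _ ha.ne', MulChar.pow_apply' _ hb.ne']
    simp only [map_mul, map_pow]
    ring
  simp only [h1]
  rw [Finset.sum_comm]
  push_cast
  rw [Finset.mul_sum]
  refine Finset.sum_congr rfl fun x _ => ?_
  rw [Finset.sum_comm, Finset.mul_sum]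
  refine Finset.sum_congr rfl fun y _ => ?_
  rw [← Finset.sum_mul, DirichletCharacter.sum_characters_eq, Nat.totient_prime hqp,
    Nat.cast_sub hqp.one_lt.le]
  split_ifs <;> simp

/-- The twisted second moment in terms of a weighted count of points on a curve. -/
theorem norm_moment_sub_curve_le {a b : ℕ} (ha : 0 < a) (hb : 0 < b) {l₁ l₂ : ZMod q}
    (hl₁ : l₁ ≠ 0) (hl₂ : l₂ ≠ 0) :
    ‖((q : ℂ) - 1)⁻¹ * (∑ χ : DirichletCharacter ℂ q, if χ = 1 then 0 else
        χ l₁ ^ a * χ l₂ ^ b * DirichletCharacter.LFunction (χ ^ a) (1 / 2) *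
          DirichletCharacter.LFunction (χ ^ b) (1 / 2)) -
      ((∑ x ∈ Finset.Ico 1 q, ∑ y ∈ Finset.Ico 1 q, (if (l₁ * x) ^ a * (l₂ * y) ^ b = 1 then
        centralWeight q x * centralWeight q y else 0) : ℝ) : ℂ)‖ ≤
      2 * (2 * ‖riemannZeta (1 / 2)‖) ^ 2 / q := by
  have hq2 : (2 : ℝ) ≤ q := by exact_mod_cast (Fact.out : q.Prime).two_le
  have hq1 : (q : ℂ) - 1 ≠ 0 := by
    rw [sub_ne_zero]; exact_mod_cast (Fact.out : q.Prime).one_lt.ne'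
  have h := sum_LFunction_mul_LFunction_eq ha hb l₁ l₂
  set S := ∑ x ∈ Finset.Ico 1 q, ∑ y ∈ Finset.Ico 1 q, (if (l₁ * x) ^ a * (l₂ * y) ^ b = 1 then
        centralWeight q x * centralWeight q y else 0)
  set F : DirichletCharacter ℂ q → ℂ := fun χ => χ l₁ ^ a * χ l₂ ^ b *
    DirichletCharacter.LFunction (χ ^ a) (1 / 2) * DirichletCharacter.LFunction (χ ^ b) (1 / 2)
    with hF
  have h1 : (∑ χ : DirichletCharacter ℂ q, if χ = 1 then 0 else F χ) = ∑ χ, F χ - F 1 := by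
    have h : ∀ χ, (if χ = 1 then 0 else F χ) = F χ - if χ = 1 then F χ else 0 := fun χ => by
      split_ifs <;> simp
    simp only [h, Finset.sum_sub_distrib, Finset.sum_ite_eq', Finset.mem_univ, if_true]
  have h2 : F 1 = ((∑ x ∈ Finset.Ico 1 q, centralWeight q x : ℝ) : ℂ) ^ 2 := by
    rw [hF]
    simp only [one_pow, MulChar.one_apply hl₁.isUnit, MulChar.one_apply hl₂.isUnit, one_mul]
    rw [LFunction_half_eq, ← sq]
    congr 1
    push_cast
    refine Finset.sum_congr rfl fun x hx => ?_
    rw [Finset.mem_Ico] at hx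
    rw [MulChar.one_apply (natCast_zmod_ne_zero hx.1 hx.2).isUnit, one_mul]
  have h3 : ‖F 1‖ ≤ (2 * ‖riemannZeta (1 / 2)‖) ^ 2 := by
    rw [h2, norm_pow, Complex.norm_real, Real.norm_eq_abs]
    gcongr
    exact abs_sum_centralWeight_le
  rw [h1, h, mul_sub, inv_mul_cancel_left₀ hq1, sub_sub_cancel_left, norm_neg, norm_mul, norm_inv]
  have h4 : ‖(q : ℂ) - 1‖ = q - 1 := by
    rw [show (q : ℂ) - 1 = ((q - 1 : ℝ) : ℂ) by push_cast; rfl, Complex.norm_real,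
      Real.norm_of_nonneg (by linarith)]
  rw [h4]
  calc ((q : ℝ) - 1)⁻¹ * ‖F 1‖ ≤ (q / 2 : ℝ)⁻¹ * (2 * ‖riemannZeta (1 / 2)‖) ^ 2 := by
        gcongr
        linarith
    _ = _ := by rw [inv_div]; ring

end Reduction

section Conclusion

theorem exists_natFloor_root {K q : ℕ} (hK : 0 < K) (hq : 32 ^ K ≤ q) :
    ∃ R : ℕ, 32 ≤ R ∧ R ^ K ≤ q ∧ q ≤ (2 * R) ^ K ∧ (q : ℝ) ^ (1 / K : ℝ) ≤ 2 * R := by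
  have hK' : (K : ℝ) ≠ 0 := by exact_mod_cast hK.ne'
  have hq0 : (0 : ℝ) ≤ q := q.cast_nonneg
  set r := (q : ℝ) ^ (1 / K : ℝ) with hr
  have hr0 : 0 ≤ r := by positivity
  have hrK : r ^ K = q := by
    rw [hr, one_div, Real.rpow_inv_natCast_pow hq0 hK.ne']
  have h32 : 32 ≤ ⌊r⌋₊ := by
    refine Nat.le_floor (le_of_pow_le_pow_left₀ hK.ne' hr0 ?_)
    rw [hrK]
    exact_mod_cast hq
  have hle : r ≤ 2 * (⌊r⌋₊ : ℝ) := by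
    have h1 : (32 : ℝ) ≤ ⌊r⌋₊ := by exact_mod_cast h32
    linarith [Nat.lt_floor_add_one r]
  refine ⟨⌊r⌋₊, h32, ?_, ?_, hle⟩
  · have h : (⌊r⌋₊ : ℝ) ^ K ≤ r ^ K := pow_le_pow_left₀ (Nat.cast_nonneg _) (Nat.floor_le hr0) K
    rw [hrK] at h
    exact_mod_cast h
  · have h := pow_le_pow_left₀ hr0 hle K
    rw [hrK] at h
    exact_mod_cast h

theorem one_add_log_sq_div_sqrt_le {K : ℕ} (hK : 0 < K) {q R : ℝ} (hq : 1 ≤ q)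
    (hR : q ^ (1 / K : ℝ) ≤ 2 * R) :
    (1 + Real.log q) ^ 2 / √R ≤ 2 * (1 + 8 * K) ^ 2 * q ^ (-(1 / (4 * K)) : ℝ) := by
  have hK' : (0 : ℝ) < K := by exact_mod_cast hK
  have hq0 : 0 < q := by linarith
  have hlog := Real.log_nonneg hq
  set t := q ^ (1 / (8 * K) : ℝ) with ht
  have ht1 : 1 ≤ t := Real.one_le_rpow hq (by positivity)
  have hpow : ∀ n : ℕ, t ^ n = q ^ (n / (8 * K) : ℝ) := fun n => by
    rw [ht, ← Real.rpow_natCast, ← Real.rpow_mul hq0.le]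
    congr 1
    ring
  have hlog' : Real.log q ≤ 8 * K * t := by
    have h := Real.log_le_rpow_div hq0.le (ε := 1 / (8 * K)) (by positivity)
    rw [div_div_eq_mul_div, div_one] at h
    linarith
  have hsq : t ^ 4 ≤ 2 * √R := by
    have h8 : t ^ 8 ≤ 2 * R := by
      rw [hpow]
      convert hR using 2
      push_cast
      field_simp
    have hR0 : 0 ≤ R := by nlinarith [one_le_pow₀ (n := 8) ht1]
    refine (pow_le_pow_iff_left₀ (by positivity) (by positivity) two_ne_zero).1 ?_
    rw [mul_pow, Real.sq_sqrt hR0]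
    nlinarith
  have ht0 : 0 < t := by linarith
  have hsR : 0 < √R := by
    have : 0 < t ^ 4 := by positivity
    linarith
  have hneg : q ^ (-(1 / (4 * K)) : ℝ) = (t ^ 2)⁻¹ := by
    rw [Real.rpow_neg hq0.le, hpow]
    congr 2
    push_cast
    field_simp
    norm_num
  rw [hneg, div_le_iff₀ hsR]
  calc (1 + Real.log q) ^ 2 ≤ ((1 + 8 * K) * t) ^ 2 := by
        gcongr
        nlinarith
    _ = (1 + 8 * K) ^ 2 * (t ^ 2)⁻¹ * t ^ 4 := by field_simp
    _ ≤ (1 + 8 * K) ^ 2 * (t ^ 2)⁻¹ * (2 * √R) := by gcongr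
    _ = _ := by ring

/-- The twisted second moment for positive exponents. -/
theorem twisted_second_moment_natCast {a b : ℕ} (ha : 0 < a) (hb : 0 < b) :
    ∃ α : ℝ, 0 < α ∧ ∃ η : ℝ, 0 < η ∧ ∃ C : ℝ, 0 < C ∧ ∃ Q : ℕ,
      ∀ (q : ℕ) [Fact (Nat.Prime q)], Q ≤ q →
        ∀ l₁ l₂ : ℕ, 1 ≤ l₁ → 1 ≤ l₂ → (l₁ : ℝ) ≤ (q : ℝ) ^ α → (l₂ : ℝ) ≤ (q : ℝ) ^ α →
          ‖((q : ℂ) - 1)⁻¹ *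
              (∑ χ : DirichletCharacter ℂ q,
                if χ = 1 then 0 else
                  (χ (l₁ : ZMod q)) ^ a * (χ (l₂ : ZMod q)) ^ b *
                    DirichletCharacter.LFunction (χ ^ a) (1 / 2) *
                    DirichletCharacter.LFunction (χ ^ b) (1 / 2)) -
            (if l₁ = 1 ∧ l₂ = 1 then (1 : ℂ) else 0)‖ ≤ C * (q : ℝ) ^ (-η) := by
  set C₀ := 2 * ‖riemannZeta (1 / 2)‖
  obtain ⟨K, hK, C, hC, H⟩ := exists_abs_sum_curve_sub_le ha hb (C₀ := C₀) (by positivity)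
  have hK' : (1 : ℝ) ≤ K := by exact_mod_cast hK
  refine ⟨1 / (2 * K), by positivity, 1 / (4 * K), by positivity,
    2 * C₀ ^ 2 + C * (2 * (1 + 8 * K) ^ 2), by positivity, 32 ^ K, ?_⟩
  intro q _ hQ l₁ l₂ hl₁ hl₂ hl₁q hl₂q
  obtain ⟨R, hR32, hRq, hqR, hroot⟩ := exists_natFloor_root hK hQ
  have hq2 : (1 : ℝ) ≤ q := by exact_mod_cast (Fact.out : q.Prime).one_lt.le
  have hq0 : (0 : ℝ) < q := by linarith
  have hR32' : (32 : ℝ) ≤ R := by exact_mod_cast hR32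
  have hsmall : ∀ {l : ℕ}, (l : ℝ) ≤ (q : ℝ) ^ (1 / (2 * K) : ℝ) → l ≤ R := fun {l} hl => by
    have h : ((q : ℝ) ^ (1 / (2 * K) : ℝ)) ^ 2 = (q : ℝ) ^ (1 / K : ℝ) := by
      rw [← Real.rpow_natCast, ← Real.rpow_mul hq0.le]
      congr 1
      push_cast
      field_simp
    have h2 : (l : ℝ) ^ 2 ≤ (R : ℝ) ^ 2 :=
      (pow_le_pow_left₀ l.cast_nonneg hl 2).trans (by rw [h]; nlinarith)
    exact_mod_cast (pow_le_pow_iff_left₀ l.cast_nonneg R.cast_nonneg two_ne_zero).1 h2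
  have hne : ∀ {l : ℕ}, 1 ≤ l → (l : ℝ) ≤ (q : ℝ) ^ (1 / (2 * K) : ℝ) → (l : ZMod q) ≠ 0 :=
    fun {l} h1 h2 => by
      refine natCast_zmod_ne_zero h1 ?_
      have h : (q : ℝ) ^ (1 / (2 * K) : ℝ) < (q : ℝ) ^ (1 : ℝ) := by
        refine Real.rpow_lt_rpow_of_exponent_lt ?_ ?_
        · exact_mod_cast (Fact.out : q.Prime).one_lt
        · rw [div_lt_one (by positivity)]
          linarith
      rw [Real.rpow_one] at h
      exact_mod_cast h2.trans_lt h
  have hcurve := H q R (centralWeight q) l₁ l₂ hR32 hRq hqR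
    (fun x hx hxq => centralWeight_succ_le hx hxq) (fun x hx hxq => abs_centralWeight_le hx hxq)
    abs_centralWeight_one_sub_one_le abs_sum_centralWeight_le hl₁ hl₂ (hsmall hl₁q) (hsmall hl₂q)
  have hmoment := norm_moment_sub_curve_le ha hb (hne hl₁ hl₁q) (hne hl₂ hl₂q)
  set S := ∑ x ∈ Finset.Ico 1 q, ∑ y ∈ Finset.Ico 1 q,
    (if ((l₁ : ZMod q) * x) ^ a * ((l₂ : ZMod q) * y) ^ b = 1 then
      centralWeight q x * centralWeight q y else 0)
  have hδ : ‖(S : ℂ) - (if l₁ = 1 ∧ l₂ = 1 then (1 : ℂ) else 0)‖ ≤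
      C * (1 + Real.log q) ^ 2 / √R := by
    rw [← Real.norm_eq_abs, ← Complex.norm_real] at hcurve
    refine le_trans (le_of_eq ?_) hcurve
    split_ifs <;> simp
  have hinv : (q : ℝ)⁻¹ ≤ (q : ℝ) ^ (-(1 / (4 * K)) : ℝ) := by
    rw [← Real.rpow_neg_one]
    refine Real.rpow_le_rpow_of_exponent_le hq2 (neg_le_neg ?_)
    rw [div_le_one (by positivity)]
    linarith
  refine (norm_sub_le_norm_sub_add_norm_sub _ (S : ℂ) _).trans ((add_le_add hmoment hδ).trans ?_)
  rw [add_mul, mul_assoc C, mul_div_assoc C, div_eq_mul_inv]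
  gcongr
  exact one_add_log_sq_div_sqrt_le hK hq2 hroot

end Conclusion

/-- For nonzero integers `a, b` with `ab > 0`, there are `α, η, C > 0` such
that for every sufficiently large prime `q` and all `1 ≤ l1, l2 ≤ q^α`, the twisted second
moment `(q−1)⁻¹ Σ_{χ ≠ 1} χ(l1)^a χ(l2)^b L(χ^a,1/2) L(χ^b,1/2)` equals `δ` up to an error
`≤ C·q^{-η}`, where `δ = 1` if `l1 = l2 = 1` and `δ = 0` otherwise. -/
theorem twisted_second_moment_same_sign (a b : ℤ) (hab : 0 < a * b) :
    ∃ α : ℝ, 0 < α ∧ ∃ η : ℝ, 0 < η ∧ ∃ C : ℝ, 0 < C ∧ ∃ Q : ℕ,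
      ∀ (q : ℕ) [Fact (Nat.Prime q)], Q ≤ q →
        ∀ l₁ l₂ : ℕ, 1 ≤ l₁ → 1 ≤ l₂ → (l₁ : ℝ) ≤ (q : ℝ) ^ α → (l₂ : ℝ) ≤ (q : ℝ) ^ α →
          ‖((q : ℂ) - 1)⁻¹ *
              (∑ χ : DirichletCharacter ℂ q,
                if χ = 1 then 0 else
                  (χ (l₁ : ZMod q)) ^ a * (χ (l₂ : ZMod q)) ^ b *
                    DirichletCharacter.LFunction (χ ^ a) (1 / 2) *
                    DirichletCharacter.LFunction (χ ^ b) (1 / 2)) -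
            (if l₁ = 1 ∧ l₂ = 1 then (1 : ℂ) else 0)‖ ≤ C * (q : ℝ) ^ (-η) := by
  rcases pos_and_pos_or_neg_and_neg_of_mul_pos hab with ⟨ha, hb⟩ | ⟨ha, hb⟩
  · lift a to ℕ using ha.le
    lift b to ℕ using hb.le
    simpa only [zpow_natCast] using
      twisted_second_moment_natCast (by exact_mod_cast ha) (by exact_mod_cast hb)
  · obtain ⟨m, rfl⟩ : ∃ m : ℕ, a = -m := ⟨a.natAbs, by omega⟩
    obtain ⟨n, rfl⟩ : ∃ n : ℕ, b = -n := ⟨b.natAbs, by omega⟩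
    obtain ⟨α, hα, η, hη, C, hC, Q, H⟩ :=
      twisted_second_moment_natCast (a := m) (b := n) (by omega) (by omega)
    refine ⟨α, hα, η, hη, C, hC, Q, fun q _ hQ l₁ l₂ hl₁ hl₂ hl₁q hl₂q => ?_⟩
    have h := H q hQ l₁ l₂ hl₁ hl₂ hl₁q hl₂q
    rw [← Equiv.sum_comp (Equiv.inv (DirichletCharacter ℂ q))] at h
    simpa only [Equiv.inv_apply, inv_eq_one, MulChar.inv_apply_eq_inv', inv_pow, zpow_neg,
      zpow_natCast] using h
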